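/- Elliptic boundary Harnack principle in Lipschitz domains (Theorem 1.5): Let K>0. There exists a constant C>0 depending only on n, λ, Λ and K such that the following holds. Let g:ℝ^{n-1}→ℝ be Lipschitz with constant K and g(0')=0, let Γ={x∈ℝⁿ : x_n=g(x')}, and for r>0 let 𝒞_r={x : |x'|<r, g(x')<x_n<g(x')+r}. Let u and v be positive solutions of tr(A(x)D²u)=0 and tr(A(x)D²v)=0 in 𝒞₁ vanishing continuously on Γ, normalized so that u(eₙ/2)=v(eₙ/2)=1. Then C^{−1} ≤ u(x)/v(x) ≤ C for every x∈𝒞_{1/2}. -/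

import Mathlib

noncomputable section
open scoped BigOperators
open Classical

abbrev Spc (m : ℕ) := EuclideanSpace ℝ (Fin (m + 1))
abbrev Spc' (m : ℕ) := EuclideanSpace ℝ (Fin m)

/-- The horizontal coordinates `x' ∈ ℝ^{n-1}` of a point `x ∈ ℝⁿ`. -/
def xprime {m : ℕ} (x : Spc m) : Spc' m :=
  (WithLp.equiv 2 _).symm fun i => x i.castSucc

/-- The last (vertical) coordinate `x_n` of a point `x ∈ ℝⁿ`. -/
def xlast {m : ℕ} (x : Spc m) : ℝ := x (Fin.last m)

/-- The `i`-th standard basis vector. -/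
def eVec (m : ℕ) (i : Fin (m + 1)) : Spc m := EuclideanSpace.single i 1

/-- The entry `∂²u/∂xᵢ∂xⱼ` of the Hessian of `u : ℝⁿ → ℝ` at `x`. -/
def eHess {m : ℕ} (u : Spc m → ℝ) (x : Spc m) (i j : Fin (m + 1)) : ℝ :=
  fderiv ℝ (fun y => fderiv ℝ u y (eVec m j)) x (eVec m i)

/-- Uniform ellipticity with symmetric coefficients: `λ|ξ|² ≤ ξ·A(x)ξ ≤ Λ|ξ|²`. -/
def IsElliptic {m : ℕ} (lam Lam : ℝ)
    (A : Spc m → Matrix (Fin (m + 1)) (Fin (m + 1)) ℝ) : Prop :=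
  (∀ x, (A x).IsSymm) ∧
  ∀ (x ξ : Spc m),
    lam * ‖ξ‖ ^ 2 ≤ ∑ i, ∑ j, ξ i * A x i j * ξ j ∧
      ∑ i, ∑ j, ξ i * A x i j * ξ j ≤ Lam * ‖ξ‖ ^ 2

/-- `u` is a (pointwise, twice continuously differentiable) solution of
`tr(A(x)D²u) = 0` on `Ω`. -/
def SolvesE {m : ℕ} (A : Spc m → Matrix (Fin (m + 1)) (Fin (m + 1)) ℝ)
    (u : Spc m → ℝ) (Ω : Set (Spc m)) : Prop :=
  ∀ x ∈ Ω, ContDiffAt ℝ 2 u x ∧ ∑ i, ∑ j, A x i j * eHess u x j i = 0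

/-- The graph `Γ = {x_n = g(x')}` in the elliptic (time-independent) setting. -/
def graphSetE {m : ℕ} (g : Spc' m → ℝ) : Set (Spc m) :=
  {x | xlast x = g (xprime x)}

/-- The cylinder `𝒞_r = {|x'| < r, g(x') < x_n < g(x') + r}`. -/
def CylE {m : ℕ} (g : Spc' m → ℝ) (r : ℝ) : Set (Spc m) :=
  {x | ‖xprime x‖ < r ∧ g (xprime x) < xlast x ∧ xlast x < g (xprime x) + r}

/-- `u` vanishes continuously on `Γ`. -/
def VanishesOnE {m : ℕ} (u : Spc m → ℝ) (Ω Γ : Set (Spc m)) : Prop :=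
  ∀ z ∈ Γ ∩ closure Ω, Filter.Tendsto u (nhdsWithin z Ω) (nhds 0)

section

open Set Filter Topology MeasureTheory Metric

variable {m : ℕ}

/-- The second derivative of `u` as a bilinear form. -/
def hessForm (u : Spc m → ℝ) (x : Spc m) : Spc m →L[ℝ] Spc m →L[ℝ] ℝ :=
  fderiv ℝ (fderiv ℝ u) x

/-- The operator `u ↦ tr(A(x) D²u(x))`. -/
def ellOp (A : Spc m → Matrix (Fin (m + 1)) (Fin (m + 1)) ℝ) (u : Spc m → ℝ) (x : Spc m) : ℝ :=
  ∑ i, ∑ j, A x i j * eHess u x j i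

lemma differentiableAt_fderiv_of_contDiffAt {u : Spc m → ℝ} {x : Spc m} (hu : ContDiffAt ℝ 2 u x) :
    DifferentiableAt ℝ (fderiv ℝ u) x :=
  (hu.fderiv_right (m := 1) (by norm_num)).differentiableAt (by norm_num)

lemma eHess_eq {u : Spc m → ℝ} {x : Spc m} (hu : ContDiffAt ℝ 2 u x) (i j : Fin (m + 1)) :
    eHess u x i j = hessForm u x (eVec m i) (eVec m j) := by
  unfold eHess hessForm
  rw [fderiv_clm_apply (differentiableAt_fderiv_of_contDiffAt hu) (differentiableAt_const _)]
  simp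

lemma hessForm_symm {u : Spc m → ℝ} {x : Spc m} (hu : ContDiffAt ℝ 2 u x) (v w : Spc m) :
    hessForm u x v w = hessForm u x w v :=
  (hu.isSymmSndFDerivAt (by simp)) v w

lemma eventually_differentiableAt {u : Spc m → ℝ} {x : Spc m} (hu : ContDiffAt ℝ 2 u x) :
    ∀ᶠ y in 𝓝 x, DifferentiableAt ℝ u y := by
  filter_upwards [hu.eventually (by simp)] with y hy
  exact hy.differentiableAt (by norm_num)

lemma hessForm_add {u v : Spc m → ℝ} {x : Spc m} (hu : ContDiffAt ℝ 2 u x)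
    (hv : ContDiffAt ℝ 2 v x) :
    hessForm (fun y => u y + v y) x = hessForm u x + hessForm v x := by
  unfold hessForm
  have : fderiv ℝ (fun y => u y + v y) =ᶠ[𝓝 x] fun y => fderiv ℝ u y + fderiv ℝ v y := by
    filter_upwards [eventually_differentiableAt hu, eventually_differentiableAt hv] with y h1 h2
    exact fderiv_fun_add h1 h2
  rw [this.fderiv_eq, fderiv_fun_add (differentiableAt_fderiv_of_contDiffAt hu)
    (differentiableAt_fderiv_of_contDiffAt hv)]

lemma hessForm_const_mul {u : Spc m → ℝ} {x : Spc m} (hu : ContDiffAt ℝ 2 u x) (c : ℝ) :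
    hessForm (fun y => c * u y) x = c • hessForm u x := by
  unfold hessForm
  have : fderiv ℝ (fun y => c * u y) =ᶠ[𝓝 x] fun y => c • fderiv ℝ u y := by
    filter_upwards [eventually_differentiableAt hu] with y h1
    exact fderiv_const_mul h1 c
  rw [this.fderiv_eq, fderiv_fun_const_smul (differentiableAt_fderiv_of_contDiffAt hu)]

lemma hessForm_const (c : ℝ) (x : Spc m) : hessForm (fun _ => c) x = 0 := by
  unfold hessForm
  have : fderiv ℝ (fun _ : Spc m => c) = fun _ => 0 := by ext1 y; simp
  rw [this]; simp

lemma ellOp_eq {u : Spc m → ℝ} {x : Spc m} (hu : ContDiffAt ℝ 2 u x)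
    (A : Spc m → Matrix (Fin (m + 1)) (Fin (m + 1)) ℝ) :
    ellOp A u x = ∑ i, ∑ j, A x i j * hessForm u x (eVec m j) (eVec m i) := by
  simp only [ellOp, eHess_eq hu]

lemma ellOp_add {u v : Spc m → ℝ} {x : Spc m} (hu : ContDiffAt ℝ 2 u x)
    (hv : ContDiffAt ℝ 2 v x) (A : Spc m → Matrix (Fin (m + 1)) (Fin (m + 1)) ℝ) :
    ellOp A (fun y => u y + v y) x = ellOp A u x + ellOp A v x := by
  rw [ellOp_eq (hu.add hv), ellOp_eq hu, ellOp_eq hv, hessForm_add hu hv]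
  simp [mul_add, Finset.sum_add_distrib]

lemma ellOp_const_mul {u : Spc m → ℝ} {x : Spc m} (hu : ContDiffAt ℝ 2 u x) (c : ℝ)
    (A : Spc m → Matrix (Fin (m + 1)) (Fin (m + 1)) ℝ) :
    ellOp A (fun y => c * u y) x = c * ellOp A u x := by
  rw [ellOp_eq (contDiffAt_const.mul hu), ellOp_eq hu, hessForm_const_mul hu]
  simp [Finset.mul_sum, mul_left_comm]

lemma ellOp_const (c : ℝ) (x : Spc m) (A : Spc m → Matrix (Fin (m + 1)) (Fin (m + 1)) ℝ) :
    ellOp A (fun _ => c) x = 0 := by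
  rw [ellOp_eq contDiffAt_const, hessForm_const]
  simp

/-- Affine combinations of solutions are solutions. -/
lemma SolvesE.comb {A : Spc m → Matrix (Fin (m + 1)) (Fin (m + 1)) ℝ} {u v : Spc m → ℝ}
    {Ω : Set (Spc m)} (hu : SolvesE A u Ω) (hv : SolvesE A v Ω) (a b c : ℝ) :
    SolvesE A (fun y => a * u y + b * v y + c) Ω := by
  intro x hx
  obtain ⟨hu1, hu2⟩ := hu x hx
  obtain ⟨hv1, hv2⟩ := hv x hx
  have h1 : ContDiffAt ℝ 2 (fun y => a * u y) x := contDiffAt_const.mul hu1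
  have h2 : ContDiffAt ℝ 2 (fun y => b * v y) x := contDiffAt_const.mul hv1
  refine ⟨(h1.add h2).add contDiffAt_const, ?_⟩
  change ellOp A (fun y => (a * u y + b * v y) + c) x = 0
  change ellOp A u x = 0 at hu2
  change ellOp A v x = 0 at hv2
  rw [ellOp_add (h1.add h2) contDiffAt_const, ellOp_add h1 h2, ellOp_const_mul hu1,
    ellOp_const_mul hv1, ellOp_const, hu2, hv2]
  simp

lemma SolvesE.affine {A : Spc m → Matrix (Fin (m + 1)) (Fin (m + 1)) ℝ} {u : Spc m → ℝ}
    {Ω : Set (Spc m)} (hu : SolvesE A u Ω) (a c : ℝ) :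
    SolvesE A (fun y => a * u y + c) Ω := by
  have := hu.comb hu a 0 c
  simpa using this

lemma SolvesE.mono {A : Spc m → Matrix (Fin (m + 1)) (Fin (m + 1)) ℝ} {u : Spc m → ℝ}
    {Ω Ω' : Set (Spc m)} (hu : SolvesE A u Ω) (h : Ω' ⊆ Ω) : SolvesE A u Ω' :=
  fun x hx => hu x (h hx)

lemma SolvesE.continuousOn {A : Spc m → Matrix (Fin (m + 1)) (Fin (m + 1)) ℝ} {u : Spc m → ℝ}
    {Ω : Set (Spc m)} (hu : SolvesE A u Ω) : ContinuousOn u Ω :=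
  fun x hx => (hu x hx).1.continuousAt.continuousWithinAt

/-- Second order necessary condition at an interior minimum. -/
lemma IsLocalMin.hessForm_nonneg {f : Spc m → ℝ} {x : Spc m} (hmin : IsLocalMin f x)
    (hf : ContDiffAt ℝ 2 f x) (ξ : Spc m) : 0 ≤ hessForm f x ξ ξ := by
  by_contra! hneg
  set ℓ : ℝ → Spc m := fun t => x + t • ξ with hℓ
  have hℓ0 : ℓ 0 = x := by simp [hℓ]
  have hℓd : ∀ t, HasDerivAt ℓ ξ t := fun t => by
    simpa [hℓ] using ((hasDerivAt_id t).smul_const ξ).const_add x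
  have hℓc : Tendsto ℓ (𝓝 0) (𝓝 x) := by
    have := (hℓd 0).continuousAt.tendsto
    rwa [hℓ0] at this
  have hd : deriv (f ∘ ℓ) =ᶠ[𝓝 0] fun t => fderiv ℝ f (ℓ t) ξ := by
    filter_upwards [hℓc.eventually (eventually_differentiableAt hf)] with t ht
    exact (ht.hasFDerivAt.comp_hasDerivAt t (hℓd t)).deriv
  have hd2 : deriv (deriv (f ∘ ℓ)) 0 = hessForm f x ξ ξ := by
    rw [hd.deriv_eq]
    have h := (differentiableAt_fderiv_of_contDiffAt hf).hasFDerivAt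
    rw [← hℓ0] at h
    have h2 := h.comp_hasDerivAt 0 (hℓd 0)
    have h3 := h2.clm_apply (hasDerivAt_const (0 : ℝ) ξ)
    have h4 := h3.deriv
    simp only [Function.comp_apply, map_zero, add_zero] at h4
    rw [h4, hℓ0]; rfl
  have hlm : IsLocalMin (f ∘ ℓ) 0 := by
    have h0 : ∀ᶠ y in 𝓝 x, f x ≤ f y := hmin
    have := hℓc.eventually h0
    change ∀ᶠ t in 𝓝 0, (f ∘ ℓ) 0 ≤ (f ∘ ℓ) t
    simpa [hℓ0] using this
  have hcont : ContinuousAt (f ∘ ℓ) 0 := by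
    refine ContinuousAt.comp ?_ (hℓd 0).continuousAt
    rw [hℓ0]; exact hf.continuousAt
  have hlM : IsLocalMax (f ∘ ℓ) 0 :=
    isLocalMax_of_deriv_deriv_neg (by rw [hd2]; exact hneg) hlm.deriv_eq_zero hcont
  have hconst : (f ∘ ℓ) =ᶠ[𝓝 0] fun _ => (f ∘ ℓ) 0 := by
    filter_upwards [hlm, hlM] with t h1 h2
    exact le_antisymm h2 h1
  have : deriv (deriv (f ∘ ℓ)) 0 = 0 := by
    rw [hconst.deriv.deriv_eq]
    simp
  rw [hd2] at this
  exact hneg.ne this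

/-- The matrix of a bilinear form in the standard basis. -/
def bilMatrix (B : Spc m →L[ℝ] Spc m →L[ℝ] ℝ) : Matrix (Fin (m + 1)) (Fin (m + 1)) ℝ :=
  fun i j => B (eVec m i) (eVec m j)

lemma sum_smul_eVec (ξ : Spc m) : ∑ i, ξ i • eVec m i = ξ := by
  have := (EuclideanSpace.basisFun (Fin (m + 1)) ℝ).sum_repr ξ
  simpa [eVec] using this

lemma bil_apply (B : Spc m →L[ℝ] Spc m →L[ℝ] ℝ) (ξ η : Spc m) :
    B ξ η = ∑ i, ∑ j, ξ i * bilMatrix B i j * η j := by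
  conv_lhs => rw [← sum_smul_eVec ξ, ← sum_smul_eVec η]
  simp only [map_sum, map_smul, _root_.sum_apply, _root_.smul_apply,
    smul_eq_mul, bilMatrix, Finset.mul_sum]
  rw [Finset.sum_comm]
  refine Finset.sum_congr rfl fun i _ => Finset.sum_congr rfl fun j _ => ?_
  ring

lemma bilMatrix_posSemidef {B : Spc m →L[ℝ] Spc m →L[ℝ] ℝ} (hs : ∀ v w, B v w = B w v)
    (hp : ∀ v, 0 ≤ B v v) : (bilMatrix B).PosSemidef := by
  refine Matrix.PosSemidef.of_dotProduct_mulVec_nonneg ?_ fun x => ?_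
  · ext i j
    simp [bilMatrix, hs (eVec m j)]
  · have := hp (WithLp.toLp 2 x)
    rw [bil_apply] at this
    simpa [dotProduct, Matrix.mulVec, Finset.mul_sum, mul_assoc] using this

open scoped MatrixOrder in
lemma IsElliptic.trace_ge {lam Lam : ℝ} {A : Spc m → Matrix (Fin (m + 1)) (Fin (m + 1)) ℝ}
    (hA : IsElliptic lam Lam A) (x : Spc m) {H : Matrix (Fin (m + 1)) (Fin (m + 1)) ℝ}
    (hH : H.PosSemidef) : lam * H.trace ≤ ∑ i, ∑ j, A x i j * H j i := by
  obtain ⟨B, hB⟩ := CStarAlgebra.nonneg_iff_eq_star_mul_self.mp hH.nonneg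
  have hB' : ∀ i j, H i j = ∑ k, B k i * B k j := fun i j => by
    rw [hB]; simp [Matrix.mul_apply, Matrix.star_apply]
  have e1 : ∑ i, ∑ j, A x i j * H j i = ∑ k, ∑ i, ∑ j, B k i * A x i j * B k j := by
    simp only [hB', Finset.mul_sum]
    rw [Finset.sum_congr rfl fun i _ => Finset.sum_comm, Finset.sum_comm]
    refine Finset.sum_congr rfl fun k _ => Finset.sum_congr rfl fun i _ =>
      Finset.sum_congr rfl fun j _ => ?_
    ring
  have e2 : lam * H.trace = ∑ k, lam * ∑ i, B k i ^ 2 := by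
    simp only [Matrix.trace, Matrix.diag, hB', Finset.mul_sum]
    rw [Finset.sum_comm]
    simp [sq]
  rw [e1, e2]
  refine Finset.sum_le_sum fun k _ => ?_
  have := (hA.2 x (WithLp.toLp 2 (B k))).1
  rw [EuclideanSpace.norm_sq_eq] at this
  simpa using this

lemma IsElliptic.diag_le {lam Lam : ℝ} {A : Spc m → Matrix (Fin (m + 1)) (Fin (m + 1)) ℝ}
    (hA : IsElliptic lam Lam A) (x : Spc m) : ∑ i, A x i i ≤ (m + 1) * Lam := by
  have : ∀ i ∈ Finset.univ, A x i i ≤ Lam := fun i _ => by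
    have := (hA.2 x (eVec m i)).2
    simpa [eVec, Pi.single_apply] using this
  simpa using Finset.sum_le_sum this

/-- A strict supersolution has no interior minimum. -/
lemma IsElliptic.not_isLocalMin {lam Lam : ℝ} (hlam : 0 < lam)
    {A : Spc m → Matrix (Fin (m + 1)) (Fin (m + 1)) ℝ}
    (hA : IsElliptic lam Lam A) {f : Spc m → ℝ} {x : Spc m} (hf : ContDiffAt ℝ 2 f x)
    (hneg : ellOp A f x < 0) : ¬ IsLocalMin f x := by
  intro hmin
  have hps := bilMatrix_posSemidef (hessForm_symm hf) (hmin.hessForm_nonneg hf)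
  have h1 := hA.trace_ge x hps
  rw [ellOp_eq hf] at hneg
  have h2 : 0 ≤ (bilMatrix (hessForm f x)).trace := hps.trace_nonneg
  have h3 : 0 ≤ lam * (bilMatrix (hessForm f x)).trace := by positivity
  simp only [bilMatrix] at h1 h3
  linarith

lemma hasFDerivAt_normSq_sub (x₀ y : Spc m) :
    HasFDerivAt (fun y : Spc m => ‖y - x₀‖ ^ 2) ((2 : ℝ) • innerSL ℝ (y - x₀)) y := by
  have := ((hasFDerivAt_id y).sub_const x₀).norm_sq
  refine this.congr_fderiv ?_
  ext v; simp

lemma hessForm_radial {F F' : ℝ → ℝ} {F'' : ℝ} {x₀ x : Spc m}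
    (h1 : ∀ᶠ t in 𝓝 (‖x - x₀‖ ^ 2), HasDerivAt F (F' t) t)
    (h2 : HasDerivAt F' F'' (‖x - x₀‖ ^ 2)) (ξ η : Spc m) :
    hessForm (fun y => F (‖y - x₀‖ ^ 2)) x ξ η =
      4 * F'' * (inner ℝ (x - x₀) ξ * inner ℝ (x - x₀) η) +
        2 * F' (‖x - x₀‖ ^ 2) * inner ℝ ξ η := by
  unfold hessForm
  have hc : Tendsto (fun y : Spc m => ‖y - x₀‖ ^ 2) (𝓝 x) (𝓝 (‖x - x₀‖ ^ 2)) :=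
    (hasFDerivAt_normSq_sub x₀ x).continuousAt
  have e : fderiv ℝ (fun y : Spc m => F (‖y - x₀‖ ^ 2)) =ᶠ[𝓝 x]
      fun y => F' (‖y - x₀‖ ^ 2) • ((2 : ℝ) • innerSL ℝ (y - x₀)) := by
    filter_upwards [hc.eventually h1] with y hy
    exact (hy.comp_hasFDerivAt y (hasFDerivAt_normSq_sub x₀ y)).fderiv
  rw [e.fderiv_eq]
  have d1 := h2.comp_hasFDerivAt x (hasFDerivAt_normSq_sub x₀ x)
  have d2 : HasFDerivAt (fun y : Spc m => (2 : ℝ) • innerSL ℝ (y - x₀))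
      ((2 : ℝ) • innerSL ℝ) x := by
    have h3 : HasFDerivAt (fun y : Spc m => innerSL ℝ (y - x₀)) (innerSL ℝ) x := by
      have := (innerSL ℝ (E := Spc m)).hasFDerivAt.comp x ((hasFDerivAt_id x).sub_const x₀)
      simpa [Function.comp_def] using this
    exact h3.const_smul (2 : ℝ)
  have d3 : fderiv ℝ (fun y => F' (‖y - x₀‖ ^ 2) • ((2 : ℝ) • innerSL ℝ (y - x₀))) x = _ :=
    HasFDerivAt.fderiv (d1.smul d2)
  rw [d3]
  simp only [_root_.add_apply, _root_.smul_apply, Function.comp_apply, smul_eq_mul,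
    ContinuousLinearMap.smulRight_apply, innerSL_apply_apply]
  have e5 : (innerSL ℝ : Spc m →L[ℝ] Spc m →L[ℝ] ℝ) ξ η = inner ℝ ξ η := rfl
  rw [e5]
  ring

lemma eVec_inner (v : Spc m) (i : Fin (m + 1)) : inner ℝ v (eVec m i) = v i := by
  simp [eVec, EuclideanSpace.inner_single_right]

lemma eVec_apply (i k : Fin (m + 1)) : eVec m i k = if k = i then (1 : ℝ) else 0 := by
  simp [eVec]

lemma eVec_inner_eVec (i j : Fin (m + 1)) :
    inner ℝ (eVec m i) (eVec m j) = if i = j then (1 : ℝ) else 0 := by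
  simp [eVec, EuclideanSpace.inner_single_right, eq_comm]

lemma ellOp_radial {F F' : ℝ → ℝ} {F'' : ℝ} {x₀ x : Spc m}
    (hF : ContDiffAt ℝ 2 (fun y : Spc m => F (‖y - x₀‖ ^ 2)) x)
    (h1 : ∀ᶠ t in 𝓝 (‖x - x₀‖ ^ 2), HasDerivAt F (F' t) t)
    (h2 : HasDerivAt F' F'' (‖x - x₀‖ ^ 2))
    (A : Spc m → Matrix (Fin (m + 1)) (Fin (m + 1)) ℝ) :
    ellOp A (fun y => F (‖y - x₀‖ ^ 2)) x =
      4 * F'' * (∑ i, ∑ j, (x - x₀) i * A x i j * (x - x₀) j) +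
        2 * F' (‖x - x₀‖ ^ 2) * ∑ i, A x i i := by
  rw [ellOp_eq hF]
  simp only [hessForm_radial h1 h2, eVec_inner, eVec_apply, mul_add, Finset.sum_add_distrib,
    Finset.mul_sum, mul_ite, mul_one, mul_zero]
  congr 1
  · refine Finset.sum_congr rfl fun i _ => Finset.sum_congr rfl fun j _ => ?_
    ring
  · simp only [Finset.sum_ite_eq, Finset.mem_univ, if_true]
    exact Finset.sum_congr rfl fun i _ => by ring

/-- The radial function `|y - x₀|^{-2q}`. -/
def powBar (q : ℕ) (x₀ y : Spc m) : ℝ := ((‖y - x₀‖ ^ 2)⁻¹) ^ q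

lemma hasDerivAt_inv_pow (q : ℕ) {t : ℝ} (ht : t ≠ 0) :
    HasDerivAt (fun t : ℝ => (t⁻¹) ^ q) (-(q : ℝ) * (t⁻¹) ^ (q + 1)) t := by
  have := (hasDerivAt_inv ht).pow q
  refine this.congr_deriv ?_
  rcases q with _ | q
  · simp
  · rw [Nat.add_sub_cancel, ← inv_pow]; ring

lemma powBar_contDiffAt (q : ℕ) {x₀ x : Spc m} (hx : x ≠ x₀) :
    ContDiffAt ℝ 2 (powBar q x₀) x := by
  unfold powBar
  have h : ‖x - x₀‖ ^ 2 ≠ 0 := by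
    have := norm_pos_iff.mpr (sub_ne_zero.mpr hx); positivity
  have h1 : ContDiffAt ℝ 2 (fun y : Spc m => ‖y - x₀‖ ^ 2) x :=
    (contDiffAt_id.sub contDiffAt_const).norm_sq ℝ
  exact (h1.inv h).pow q

lemma powBar_ellOp_pos {lam Lam : ℝ}
    {A : Spc m → Matrix (Fin (m + 1)) (Fin (m + 1)) ℝ} (hA : IsElliptic lam Lam A) {q : ℕ}
    (hq : 1 ≤ q) (hq2 : (m + 1) * Lam < 2 * (q + 1) * lam) {x₀ x : Spc m} (hx : x ≠ x₀) :
    0 < ellOp A (powBar q x₀) x := by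
  have hn : 0 < ‖x - x₀‖ := norm_pos_iff.mpr (sub_ne_zero.mpr hx)
  have h : 0 < ‖x - x₀‖ ^ 2 := by positivity
  have h1 : ∀ᶠ t in 𝓝 (‖x - x₀‖ ^ 2),
      HasDerivAt (fun t : ℝ => (t⁻¹) ^ q) (-(q : ℝ) * (t⁻¹) ^ (q + 1)) t := by
    filter_upwards [isOpen_ne.mem_nhds h.ne'] with t ht
    exact hasDerivAt_inv_pow q ht
  have h2 := (hasDerivAt_inv_pow (q + 1) h.ne').const_mul (-(q : ℝ))
  have e := ellOp_radial (powBar_contDiffAt q hx) h1 h2 A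
  change ellOp A (powBar q x₀) x = _ at e
  rw [e]
  have b1 := (hA.2 x (x - x₀)).1
  have b2 := hA.diag_le x
  set t := ‖x - x₀‖ ^ 2
  set S := ∑ i, ∑ j, (x - x₀) i * A x i j * (x - x₀) j
  set T := ∑ i, A x i i
  have hti : t⁻¹ * t = 1 := inv_mul_cancel₀ h.ne'
  have hq' : (0 : ℝ) < q := by exact_mod_cast hq
  have hp : 0 < (t⁻¹) ^ (q + 1) := by positivity
  have hp2 : (t⁻¹) ^ (q + 1 + 1) * t = (t⁻¹) ^ (q + 1) := by
    rw [pow_succ, mul_assoc, hti, mul_one]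
  have key : 4 * (-(q : ℝ) * (-((q + 1 : ℕ) : ℝ) * (t⁻¹) ^ (q + 1 + 1))) * S +
      2 * (-(q : ℝ) * (t⁻¹) ^ (q + 1)) * T =
      2 * q * (2 * (q + 1) * ((t⁻¹) ^ (q + 1 + 1) * S) - (t⁻¹) ^ (q + 1) * T) := by
    push_cast; ring
  rw [key]
  have c1 : lam * (t⁻¹) ^ (q + 1) ≤ (t⁻¹) ^ (q + 1 + 1) * S := by
    rw [← hp2]
    have : 0 ≤ (t⁻¹) ^ (q + 1 + 1) := by positivity
    nlinarith
  have c2 : (t⁻¹) ^ (q + 1) * T ≤ (t⁻¹) ^ (q + 1) * ((m + 1) * Lam) := by gcongr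
  have c3 : (t⁻¹) ^ (q + 1) * ((m + 1) * Lam) < (t⁻¹) ^ (q + 1) * (2 * (q + 1) * lam) := by gcongr
  have c4 : 2 * ((q : ℝ) + 1) * (lam * (t⁻¹) ^ (q + 1)) ≤
    2 * (q + 1) * ((t⁻¹) ^ (q + 1 + 1) * S) := by gcongr
  apply mul_pos (by positivity)
  linarith

/-- Weak minimum principle in a form adapted to barriers. -/
lemma nonneg_of_no_interior_min {S : Set (Spc m)} (hS : IsOpen S) (hb : Bornology.IsBounded S)
    {h : Spc m → ℝ} (hc : ContinuousOn h S)
    (hbd : ∀ z ∈ closure S, z ∉ S → ∀ ε > 0, ∀ᶠ x in 𝓝[S] z, -ε < h x)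
    (hmin : ∀ x ∈ S, h x < 0 → ¬ IsLocalMin h x) : ∀ x ∈ S, 0 ≤ h x := by
  intro x₁ hx₁
  by_contra! hneg
  set K := {x ∈ S | h x ≤ h x₁}
  have hKS : K ⊆ S := fun x hx => hx.1
  have hKc : IsClosed K := by
    refine isClosed_of_closure_subset fun z hz => ?_
    have hzS : z ∈ closure S := closure_mono hKS hz
    have hfr : ∃ᶠ x in 𝓝 z, x ∈ K := mem_closure_iff_frequently.mp hz
    by_cases hzs : z ∈ S
    · refine ⟨hzs, ?_⟩
      by_contra! hlt
      have hcz : ContinuousAt h z := hc.continuousAt (hS.mem_nhds hzs)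
      obtain ⟨x, hx1, hx2⟩ := (hfr.and_eventually (hcz.eventually (lt_mem_nhds hlt))).exists
      exact absurd hx1.2 (not_le.mpr hx2)
    · have := eventually_nhdsWithin_iff.mp (hbd z hzS hzs (-h x₁) (by linarith))
      obtain ⟨x, hx1, hx2⟩ := (hfr.and_eventually this).exists
      have h3 := hx2 hx1.1
      have h4 := hx1.2
      linarith
  have hKcomp : IsCompact K := isCompact_of_isClosed_isBounded hKc (hb.subset hKS)
  obtain ⟨z, hzK, hz⟩ := hKcomp.exists_isMinOn ⟨x₁, hx₁, le_rfl⟩ (hc.mono hKS)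
  refine hmin z hzK.1 (hzK.2.trans_lt hneg) ?_
  filter_upwards [hS.mem_nhds hzK.1] with y hy
  by_cases hyK : h y ≤ h x₁
  · exact hz ⟨hy, hyK⟩
  · exact hzK.2.trans (not_le.mp hyK).le

/-- Comparison of a solution with a radial barrier `a|y - x₀|^{-2q} + b`. -/
lemma SolvesE.barrier_le {lam Lam : ℝ} (hlam : 0 < lam)
    {A : Spc m → Matrix (Fin (m + 1)) (Fin (m + 1)) ℝ} (hA : IsElliptic lam Lam A) {q : ℕ}
    (hq : 1 ≤ q) (hq2 : (m + 1) * Lam < 2 * (q + 1) * lam) {S : Set (Spc m)} (hS : IsOpen S)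
    (hb : Bornology.IsBounded S) {u : Spc m → ℝ} (hu : SolvesE A u S) {x₀ : Spc m}
    (hx₀ : x₀ ∉ S) {a b : ℝ} (ha : 0 < a)
    (hbd : ∀ z ∈ closure S, z ∉ S → ∀ ε > 0, ∀ᶠ x in 𝓝[S] z, a * powBar q x₀ x + b - ε < u x) :
    ∀ x ∈ S, a * powBar q x₀ x + b ≤ u x := by
  have hne : ∀ x ∈ S, x ≠ x₀ := fun x hx h => hx₀ (h ▸ hx)
  have hcd : ∀ x ∈ S, ContDiffAt ℝ 2 (fun y => (-a) * powBar q x₀ y) x := fun x hx =>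
    contDiffAt_const.mul (powBar_contDiffAt q (hne x hx))
  have hcd2 : ∀ x ∈ S, ContDiffAt ℝ 2 (fun y => (u y + (-b)) + (-a) * powBar q x₀ y) x :=
    fun x hx => ((hu x hx).1.add contDiffAt_const).add (hcd x hx)
  have := nonneg_of_no_interior_min hS hb
    (h := fun y => (u y + (-b)) + (-a) * powBar q x₀ y)
    (fun x hx => (hcd2 x hx).continuousAt.continuousWithinAt)
    (fun z hz hzS ε hε => by
      filter_upwards [hbd z hz hzS ε hε] with x hx
      linarith)
    (fun x hx _ => by
      refine hA.not_isLocalMin hlam (hcd2 x hx) ?_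
      rw [ellOp_add ((hu x hx).1.add contDiffAt_const) (hcd x hx),
        ellOp_add (hu x hx).1 contDiffAt_const, ellOp_const,
        ellOp_const_mul (powBar_contDiffAt q (hne x hx))]
      have h1 : ellOp A u x = 0 := (hu x hx).2
      have h2 := powBar_ellOp_pos hA hq hq2 (hne x hx)
      rw [h1]
      nlinarith)
  intro x hx
  have h := this x hx
  linarith

/-- Spreading of positivity from a ball to a larger ball. -/
lemma SolvesE.spread {lam Lam : ℝ} (hlam : 0 < lam)
    {A : Spc m → Matrix (Fin (m + 1)) (Fin (m + 1)) ℝ} (hA : IsElliptic lam Lam A) {q : ℕ}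
    (hq : 1 ≤ q) (hq2 : (m + 1) * Lam < 2 * (q + 1) * lam) {u : Spc m → ℝ} {x₀ : Spc m}
    {ρ R σ : ℝ} (hρ : 0 < ρ) (hσ : 0 < σ) (hu : SolvesE A u (closedBall x₀ R))
    (hu0 : ∀ x ∈ closedBall x₀ R, 0 ≤ u x) (huρ : ∀ x ∈ closedBall x₀ ρ, σ ≤ u x)
    {x : Spc m} (hx1 : ρ ≤ ‖x - x₀‖) (hx2 : ‖x - x₀‖ ≤ R) :
    σ * (ρ ^ 2) ^ q * (((‖x - x₀‖ ^ 2)⁻¹) ^ q - ((R ^ 2)⁻¹) ^ q) ≤ u x := by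
  have hpos : 0 < (ρ ^ 2) ^ q := by positivity
  have hR : 0 < R := by linarith
  rcases hx1.eq_or_lt with hx1' | hx1'
  · have h1 := huρ x (by rw [mem_closedBall_iff_norm, ← hx1'])
    rw [← hx1']
    have : (ρ ^ 2) ^ q * ((ρ ^ 2)⁻¹) ^ q = 1 := by
      rw [← mul_pow, mul_inv_cancel₀ (by positivity), one_pow]
    have h3 : 0 ≤ σ * (ρ ^ 2) ^ q * ((R ^ 2)⁻¹) ^ q := by positivity
    calc _ = σ * ((ρ ^ 2) ^ q * ((ρ ^ 2)⁻¹) ^ q) - σ * (ρ ^ 2) ^ q * ((R ^ 2)⁻¹) ^ q := by ring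
      _ ≤ σ := by rw [this]; linarith
      _ ≤ u x := h1
  rcases hx2.eq_or_lt with hx2' | hx2'
  · rw [hx2']; simpa using hu0 x (by rw [mem_closedBall_iff_norm, ← hx2'])
  set S : Set (Spc m) := ball x₀ R ∩ (closedBall x₀ ρ)ᶜ with hSdef
  have hS : IsOpen S := isOpen_ball.inter isClosed_closedBall.isOpen_compl
  have hSb : Bornology.IsBounded S := isBounded_ball.subset inter_subset_left
  have hSsub : S ⊆ closedBall x₀ R := inter_subset_left.trans ball_subset_closedBall
  have hclS : closure S ⊆ closedBall x₀ R ∩ (ball x₀ ρ)ᶜ := by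
    refine closure_minimal (fun y hy => ⟨hSsub hy, fun h => hy.2 (ball_subset_closedBall h)⟩) ?_
    exact isClosed_closedBall.inter isOpen_ball.isClosed_compl
  have := SolvesE.barrier_le hlam hA hq hq2 hS hSb (hu.mono hSsub) (x₀ := x₀)
    (fun h => h.2 (mem_closedBall_self hρ.le)) (a := σ * (ρ ^ 2) ^ q)
    (b := - (σ * (ρ ^ 2) ^ q * ((R ^ 2)⁻¹) ^ q)) (by positivity)
    (fun z hz hzS ε hε => by
      obtain ⟨hz1, hz2⟩ := hclS hz
      have hz1' : ‖z - x₀‖ ≤ R := mem_closedBall_iff_norm.mp hz1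
      have hz2' : ρ ≤ ‖z - x₀‖ := by
        simpa [dist_eq_norm] using hz2
      have hzne : z ≠ x₀ := fun h => by simp [h] at hz2'; linarith
      have hcu : ContinuousAt u z := (hu z hz1).1.continuousAt
      have hcp : ContinuousAt (fun y => σ * (ρ ^ 2) ^ q * powBar q x₀ y +
          -(σ * (ρ ^ 2) ^ q * ((R ^ 2)⁻¹) ^ q) - ε) z :=
        ((continuousAt_const.mul (powBar_contDiffAt q hzne).continuousAt).add
          continuousAt_const).sub continuousAt_const
      refine eventually_nhdsWithin_of_eventually_nhds (hcp.eventually_lt hcu ?_)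
      by_cases hzR : ‖z - x₀‖ = R
      · have := hu0 z hz1
        simp only [powBar, hzR]; linarith
      · have hzr : ‖z - x₀‖ = ρ := by
          by_contra hne
          refine hzS ⟨mem_ball_iff_norm.mpr (lt_of_le_of_ne hz1' hzR), fun h => ?_⟩
          exact hne (le_antisymm (mem_closedBall_iff_norm.mp h) hz2')
        have h1 := huρ z (mem_closedBall_iff_norm.mpr hzr.le)
        have e1 : (ρ ^ 2) ^ q * ((ρ ^ 2)⁻¹) ^ q = 1 := by
          rw [← mul_pow, mul_inv_cancel₀ (by positivity), one_pow]
        have h3 : 0 ≤ σ * (ρ ^ 2) ^ q * ((R ^ 2)⁻¹) ^ q := by positivity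
        simp only [powBar, hzr]
        rw [mul_assoc, e1]
        linarith) x
    ⟨mem_ball_iff_norm.mpr hx2', fun h => absurd (mem_closedBall_iff_norm.mp h) (not_le.mpr hx1')⟩
  simp only [powBar] at this
  linarith

lemma Matrix.PosSemidef.abs_det_le {n : Type*} [Fintype n] [DecidableEq n] {P : Matrix n n ℝ}
    (hP : P.PosSemidef) {τ : ℝ} (h : P.trace ≤ τ) : |P.det| ≤ τ ^ Fintype.card n := by
  have htr := hP.isHermitian.trace_eq_sum_eigenvalues
  have hdet := hP.isHermitian.det_eq_prod_eigenvalues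
  simp only [RCLike.ofReal_real_eq_id, id_eq] at htr hdet
  have hle : ∀ i, hP.isHermitian.eigenvalues i ≤ τ := fun i =>
    (Finset.single_le_sum (fun j _ => hP.eigenvalues_nonneg j) (Finset.mem_univ i)).trans
      (htr ▸ h)
  rw [hdet, abs_of_nonneg (Finset.prod_nonneg fun i _ => hP.eigenvalues_nonneg i)]
  calc ∏ i, hP.isHermitian.eigenvalues i ≤ ∏ _i : n, τ :=
        Finset.prod_le_prod (fun i _ => hP.eigenvalues_nonneg i) fun i _ => hle i
    _ = τ ^ Fintype.card n := by simp

/-- The map sending a contact point to the vertex of the touching paraboloid of opening `a`. -/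
def vertexMap (u : Spc m → ℝ) (a : ℝ) (x : Spc m) : Spc m :=
  x + a⁻¹ • (InnerProductSpace.toDual ℝ (Spc m)).symm (fderiv ℝ u x)

/-- The derivative of `vertexMap`. -/
def vertexDeriv (u : Spc m → ℝ) (a : ℝ) (x : Spc m) : Spc m →L[ℝ] Spc m :=
  ContinuousLinearMap.id ℝ (Spc m) + a⁻¹ •
    ((InnerProductSpace.toDual ℝ (Spc m)).symm.toContinuousLinearEquiv.toContinuousLinearMap ∘L
      hessForm u x)

lemma hasFDerivAt_vertexMap {u : Spc m → ℝ} {x : Spc m} (hu : ContDiffAt ℝ 2 u x) (a : ℝ) :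
    HasFDerivAt (vertexMap u a) (vertexDeriv u a x) x := by
  have h1 := (differentiableAt_fderiv_of_contDiffAt hu).hasFDerivAt
  have h2 := ((InnerProductSpace.toDual ℝ
    (Spc m)).symm.toContinuousLinearEquiv.toContinuousLinearMap).hasFDerivAt.comp x h1
  exact (hasFDerivAt_id x).add (h2.const_smul a⁻¹)

/-- The inner product as a bilinear form. -/
def innerForm : Spc m →L[ℝ] Spc m →L[ℝ] ℝ := innerSL ℝ

/-- The form `ξ, η ↦ ⟪ξ, η⟫ + a⁻¹ D²u(x)(ξ, η)`. -/
def shiftForm (u : Spc m → ℝ) (a : ℝ) (x : Spc m) : Spc m →L[ℝ] Spc m →L[ℝ] ℝ :=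
  innerForm + a⁻¹ • hessForm u x

lemma shiftForm_apply (u : Spc m → ℝ) (a : ℝ) (x ξ η : Spc m) :
    shiftForm u a x ξ η = inner ℝ ξ η + a⁻¹ * hessForm u x ξ η := rfl

lemma det_vertexDeriv {u : Spc m → ℝ} {x : Spc m} (hu : ContDiffAt ℝ 2 u x) (a : ℝ) :
    (vertexDeriv u a x).det = (bilMatrix (shiftForm u a x)).det := by
  rw [ContinuousLinearMap.det,
    ← LinearMap.det_toMatrix (EuclideanSpace.basisFun (Fin (m + 1)) ℝ).toBasis]
  congr 1
  ext i j
  have h2 : ∀ v : Spc m →L[ℝ] ℝ, ((InnerProductSpace.toDual ℝ (Spc m)).symm v) i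
      = v (eVec m i) := fun v => by
    rw [← eVec_inner, InnerProductSpace.toDual_symm_apply]
  have h3 : (EuclideanSpace.basisFun (Fin (m + 1)) ℝ) j = eVec m j := by simp [eVec]
  rw [LinearMap.toMatrix_apply]
  simp only [OrthonormalBasis.coe_toBasis, OrthonormalBasis.coe_toBasis_repr_apply,
    EuclideanSpace.basisFun_repr, h3]
  have : ((vertexDeriv u a x : Spc m →ₗ[ℝ] Spc m) (eVec m j)) i =
      eVec m j i + a⁻¹ * hessForm u x (eVec m j) (eVec m i) := by
    rw [← h2]; rfl
  rw [this, bilMatrix, shiftForm_apply, eVec_inner_eVec, eVec_apply, hessForm_symm hu]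

lemma bilMatrix_shiftForm_trace_le {lam Lam : ℝ} (hlam : 0 < lam)
    {A : Spc m → Matrix (Fin (m + 1)) (Fin (m + 1)) ℝ} (hA : IsElliptic lam Lam A)
    {u : Spc m → ℝ} {x : Spc m} (hu : ContDiffAt ℝ 2 u x) (hsol : ellOp A u x = 0) {a : ℝ}
    (hps : (bilMatrix (shiftForm u a x)).PosSemidef) :
    (bilMatrix (shiftForm u a x)).trace ≤ (m + 1) * Lam / lam := by
  have h1 := hA.trace_ge x hps
  have h2 := hA.diag_le x
  rw [ellOp_eq hu] at hsol
  have h3 : ∑ i, ∑ j, A x i j * bilMatrix (shiftForm u a x) j i =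
      ∑ i, A x i i + a⁻¹ * ∑ i, ∑ j, A x i j * hessForm u x (eVec m j) (eVec m i) := by
    simp only [bilMatrix, shiftForm_apply, eVec_inner_eVec, mul_add, Finset.sum_add_distrib,
      Finset.mul_sum, mul_ite, mul_one, mul_zero, Finset.sum_ite_eq', Finset.mem_univ, if_true]
    congr 1
    refine Finset.sum_congr rfl fun i _ => Finset.sum_congr rfl fun j _ => ?_
    ring
  rw [h3, hsol] at h1
  rw [le_div_iff₀ hlam]
  linarith

/-- A touching paraboloid has its vertex in the image of the contact set. -/
lemma exists_contact {A : Spc m → Matrix (Fin (m + 1)) (Fin (m + 1)) ℝ} {u : Spc m → ℝ}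
    {x₀ x₁ y : Spc m} {r s : ℝ} (hr : 0 < r) (hs : 0 < s)
    (hu : SolvesE A u (closedBall x₀ r)) (hu0 : ∀ x ∈ closedBall x₀ r, 0 ≤ u x)
    (hx₁ : x₁ ∈ closedBall x₀ (r / 4)) (hux₁ : u x₁ ≤ s) (hy : y ∈ closedBall x₀ (r / 4)) :
    ∃ z ∈ closedBall x₀ r, u z ≤ 2 * s ∧
      (∀ ξ, 0 ≤ shiftForm u (8 * s / r ^ 2) z ξ ξ) ∧ vertexMap u (8 * s / r ^ 2) z = y := by
  set a := 8 * s / r ^ 2 with ha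
  have hapos : 0 < a := by positivity
  have har : a * r ^ 2 = 8 * s := by rw [ha]; field_simp
  have hcf : ContinuousOn (fun z => u z + a / 2 * ‖z - y‖ ^ 2) (closedBall x₀ r) :=
    hu.continuousOn.add (by fun_prop)
  obtain ⟨z, hz, hzmin⟩ := (isCompact_closedBall x₀ r).exists_isMinOn
    ⟨x₀, mem_closedBall_self hr.le⟩ hcf
  have hx₁' : x₁ ∈ closedBall x₀ r := closedBall_subset_closedBall (by linarith) hx₁
  have h1 : u z + a / 2 * ‖z - y‖ ^ 2 ≤ u x₁ + a / 2 * ‖x₁ - y‖ ^ 2 := hzmin hx₁'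
  have h2 : ‖x₁ - y‖ ≤ r / 2 := by
    have e1 := mem_closedBall.mp hx₁
    have e2 := mem_closedBall'.mp hy
    rw [← dist_eq_norm]
    linarith [dist_triangle x₁ x₀ y]
  have h2' : ‖x₁ - y‖ ^ 2 ≤ (r / 2) ^ 2 := by gcongr
  have h3 : a / 2 * ‖x₁ - y‖ ^ 2 ≤ s := by nlinarith
  have huz := hu0 z hz
  have hzball : z ∈ ball x₀ r := by
    by_contra hne
    have e1 : r ≤ dist z x₀ := by simpa using hne
    have e2 := mem_closedBall.mp hy
    have e3 : 3 * r / 4 ≤ ‖z - y‖ := by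
      rw [← dist_eq_norm]; linarith [dist_triangle z y x₀]
    have e3' : (3 * r / 4) ^ 2 ≤ ‖z - y‖ ^ 2 := by gcongr
    nlinarith
  have hzc := (hu z hz).1
  have hF1 : ∀ᶠ t in 𝓝 (‖z - y‖ ^ 2), HasDerivAt (fun t : ℝ => a / 2 * t) (a / 2) t :=
    Eventually.of_forall fun t => by simpa using (hasDerivAt_id t).const_mul (a / 2)
  have hqc : ContDiffAt ℝ 2 (fun z : Spc m => a / 2 * ‖z - y‖ ^ 2) z :=
    contDiffAt_const.mul ((contDiffAt_id.sub contDiffAt_const).norm_sq ℝ)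
  have hloc : IsLocalMin (fun z => u z + a / 2 * ‖z - y‖ ^ 2) z := by
    filter_upwards [isOpen_ball.mem_nhds hzball] with w hw
    exact hzmin (ball_subset_closedBall hw)
  refine ⟨z, hz, ?_, fun ξ => ?_, ?_⟩
  · have : 0 ≤ a / 2 * ‖z - y‖ ^ 2 := by positivity
    linarith
  · have h4 := hloc.hessForm_nonneg (hzc.add hqc) ξ
    rw [hessForm_add hzc hqc] at h4
    have h5 := hessForm_radial hF1 (hasDerivAt_const _ (a / 2)) ξ ξ
    rw [_root_.add_apply, _root_.add_apply, h5] at h4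
    have h6 : 0 ≤ a⁻¹ * (hessForm u z ξ ξ + a * inner ℝ ξ ξ) :=
      mul_nonneg (by positivity) (by linarith)
    rw [shiftForm_apply]
    rw [mul_add, ← mul_assoc, inv_mul_cancel₀ hapos.ne'] at h6
    linarith
  · have h4 := hloc.fderiv_eq_zero
    have h5 : HasFDerivAt (fun z : Spc m => a / 2 * ‖z - y‖ ^ 2)
      ((a / 2) • ((2 : ℝ) • innerSL ℝ (z - y))) z := (hasFDerivAt_normSq_sub y z).const_mul _
    rw [fderiv_fun_add (hzc.differentiableAt (by norm_num)) h5.differentiableAt, h5.fderiv] at h4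
    have h6 : fderiv ℝ u z = InnerProductSpace.toDual ℝ (Spc m) (-a • (z - y)) := by
      ext v
      have := congrArg (fun L : Spc m →L[ℝ] ℝ => L v) h4
      simp only [_root_.add_apply, _root_.smul_apply, innerSL_apply_apply, smul_eq_mul,
        _root_.zero_apply] at this
      rw [InnerProductSpace.toDual_apply_apply, inner_smul_left]
      simp only [conj_trivial]
      linarith
    rw [vertexMap, h6, LinearIsometryEquiv.symm_apply_apply, smul_smul]
    have : a⁻¹ * -a = -1 := by field_simp
    rw [this]; simp

lemma continuousOn_hessForm {A : Spc m → Matrix (Fin (m + 1)) (Fin (m + 1)) ℝ} {u : Spc m → ℝ}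
    {Ω : Set (Spc m)} (hu : SolvesE A u Ω) : ContinuousOn (hessForm u) Ω := fun x hx => by
  have h1 : ContDiffAt ℝ 1 (fderiv ℝ u) x := (hu x hx).1.fderiv_right (by norm_num)
  have h2 : ContDiffAt ℝ 0 (fderiv ℝ (fderiv ℝ u)) x := h1.fderiv_right (by norm_num)
  exact h2.continuousAt.continuousWithinAt

/-- Basic measure estimate: a nonnegative solution which is small at a point near the centre of a
ball is small on a fixed proportion of the ball. -/
lemma exists_measure_estimate (m : ℕ) {lam Lam : ℝ} (hlam : 0 < lam) (hLam : lam ≤ Lam) :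
    ∃ ε : ℝ, 0 < ε ∧ ∀ A : Spc m → Matrix (Fin (m + 1)) (Fin (m + 1)) ℝ, IsElliptic lam Lam A →
      ∀ (u : Spc m → ℝ) (x₀ x₁ : Spc m) (r s : ℝ), 0 < r → 0 < s →
        SolvesE A u (closedBall x₀ r) → (∀ x ∈ closedBall x₀ r, 0 ≤ u x) →
        x₁ ∈ closedBall x₀ (r / 4) → u x₁ ≤ s →
        ENNReal.ofReal ε * volume (closedBall x₀ r) ≤
          volume ({x | u x ≤ 2 * s} ∩ closedBall x₀ r) := by
  set D : ℝ := ((m + 1) * Lam / lam) ^ (m + 1) with hD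
  have hLam0 : 0 < Lam := hlam.trans_le hLam
  have hDpos : 0 < D := by positivity
  refine ⟨(1 / 4) ^ (m + 1) / D, by positivity, ?_⟩
  intro A hA u x₀ x₁ r s hr hs hu hu0 hx₁ hux₁
  set a := 8 * s / r ^ 2 with ha
  have hch : ContinuousOn (hessForm u) (closedBall x₀ r) := continuousOn_hessForm hu
  set S : Set (Spc m) := {x ∈ closedBall x₀ r | u x ≤ 2 * s ∧ ∀ ξ, 0 ≤ shiftForm u a x ξ ξ} with hS
  have hSclosed : IsClosed S := by
    have e : S = (closedBall x₀ r ∩ u ⁻¹' Iic (2 * s)) ∩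
        ⋂ ξ, (closedBall x₀ r ∩ (fun x => shiftForm u a x ξ ξ) ⁻¹' Ici 0) := by
      ext x
      simp only [hS, mem_ofPred_eq, mem_inter_iff, mem_preimage, mem_Iic, mem_iInter, mem_Ici]
      constructor
      · exact fun h => ⟨⟨h.1, h.2.1⟩, fun ξ => ⟨h.1, h.2.2 ξ⟩⟩
      · exact fun h => ⟨h.1.1, h.1.2, fun ξ => (h.2 ξ).2⟩
    rw [e]
    refine (hu.continuousOn.preimage_isClosed_of_isClosed isClosed_closedBall isClosed_Iic).inter
      (isClosed_iInter fun ξ => ?_)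
    refine ContinuousOn.preimage_isClosed_of_isClosed ?_ isClosed_closedBall isClosed_Ici
    simp only [shiftForm_apply]
    exact continuousOn_const.add (continuousOn_const.mul
      ((hch.clm_apply continuousOn_const).clm_apply continuousOn_const))
  have himg : closedBall x₀ (r / 4) ⊆ vertexMap u a '' S := fun y hy => by
    obtain ⟨z, hz, h1, h2, h3⟩ := exists_contact hr hs hu hu0 hx₁ hux₁ hy
    exact ⟨z, ⟨hz, h1, h2⟩, h3⟩
  have hdet : ∀ x ∈ S, ENNReal.ofReal |(vertexDeriv u a x).det| ≤ ENNReal.ofReal D := by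
    intro x hx
    have hc := (hu x hx.1).1
    have hps : (bilMatrix (shiftForm u a x)).PosSemidef := by
      refine bilMatrix_posSemidef (fun v w => ?_) hx.2.2
      rw [shiftForm_apply, shiftForm_apply, hessForm_symm hc, real_inner_comm]
    rw [det_vertexDeriv hc]
    have := hps.abs_det_le (bilMatrix_shiftForm_trace_le hlam hA hc (hu x hx.1).2 hps)
    rw [Fintype.card_fin] at this
    exact ENNReal.ofReal_le_ofReal this
  have hmain : volume (closedBall x₀ (r / 4)) ≤ ENNReal.ofReal D * volume S := by
    calc volume (closedBall x₀ (r / 4)) ≤ volume (vertexMap u a '' S) := measure_mono himg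
      _ ≤ ∫⁻ x in S, ENNReal.ofReal |(vertexDeriv u a x).det| :=
          addHaar_image_le_lintegral_abs_det_fderiv volume hSclosed.measurableSet fun x hx =>
            (hasFDerivAt_vertexMap (hu x hx.1).1 a).hasFDerivWithinAt
      _ ≤ ∫⁻ _ in S, ENNReal.ofReal D := setLIntegral_mono' hSclosed.measurableSet hdet
      _ = ENNReal.ofReal D * volume S := by simp
  have hSsub : S ⊆ {x | u x ≤ 2 * s} ∩ closedBall x₀ r := fun x hx => ⟨hx.2.1, hx.1⟩
  refine le_trans ?_ (measure_mono hSsub)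
  have hvol : volume (closedBall x₀ (r / 4)) =
      ENNReal.ofReal ((1 / 4) ^ (m + 1)) * volume (closedBall x₀ r) := by
    rw [Measure.addHaar_closedBall volume x₀ (by positivity : 0 ≤ r / 4),
      Measure.addHaar_closedBall volume x₀ hr.le, ← mul_assoc, ← ENNReal.ofReal_mul (by positivity)]
    congr 2
    rw [finrank_euclideanSpace_fin, ← mul_pow]; congr 1; ring
  rw [hvol] at hmain
  rw [div_eq_inv_mul, ENNReal.ofReal_mul (by positivity), mul_assoc,
    ENNReal.ofReal_inv_of_pos hDpos]
  have hD0 : ENNReal.ofReal D ≠ 0 := by simpa using hDpos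
  calc (ENNReal.ofReal D)⁻¹ * (ENNReal.ofReal ((1 / 4) ^ (m + 1)) * volume (closedBall x₀ r))
      ≤ (ENNReal.ofReal D)⁻¹ * (ENNReal.ofReal D * volume S) := by gcongr
    _ = volume S := by
      rw [← mul_assoc, ENNReal.inv_mul_cancel hD0 ENNReal.ofReal_ne_top, one_mul]

/-- Vitali covering: if every ball of a family centred around `G` sticks out of `E` by a fixed
proportion while staying in `E'`, then `E' \ E` has at least a fixed proportion of the measure of
`G`. -/
lemma vitali_gain {ε r : ℝ} {E E' G : Set (Spc m)} (hEm : MeasurableSet E)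
    (c : Spc m → Spc m) (τ : Spc m → ℝ) (hτ0 : ∀ x ∈ G, 0 < τ x) (hτr : ∀ x ∈ G, τ x ≤ r)
    (hmem : ∀ x ∈ G, x ∈ closedBall (c x) (τ x)) (hτE : ∀ x ∈ G, closedBall (c x) (τ x) ⊆ E')
    (hτm : ∀ x ∈ G, ENNReal.ofReal ε * volume (closedBall (c x) (τ x)) ≤
      volume (closedBall (c x) (τ x) \ E)) :
    ENNReal.ofReal (ε / 5 ^ (m + 1)) * volume G ≤ volume (E' \ E) := by
  obtain ⟨U, hUG, hUd, hUc⟩ := Vitali.exists_disjoint_subfamily_covering_enlargement_closedBall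
    G c τ r hτr 5 (by norm_num)
  have hUcount : U.Countable := by
    refine hUd.countable_of_nonempty_interior fun x hx => ?_
    exact ⟨c x, ball_subset_interior_closedBall (mem_ball_self (hτ0 x (hUG hx)))⟩
  have hcover : G ⊆ ⋃ x ∈ U, closedBall (c x) (5 * τ x) := fun x hx => by
    obtain ⟨b, hbU, hb⟩ := hUc x hx
    exact mem_biUnion hbU (hb (hmem x hx))
  have h5 : ∀ x ∈ U, volume (closedBall (c x) (5 * τ x)) =
      ENNReal.ofReal (5 ^ (m + 1)) * volume (closedBall (c x) (τ x)) := fun x hx => by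
    have := hτ0 x (hUG hx)
    rw [Measure.addHaar_closedBall volume _ (by positivity : 0 ≤ 5 * τ x),
      Measure.addHaar_closedBall volume _ this.le, ← mul_assoc,
      ← ENNReal.ofReal_mul (by positivity),
      finrank_euclideanSpace_fin, mul_pow]
  have hsum1 : volume G ≤ ENNReal.ofReal (5 ^ (m + 1)) *
      ∑' x : U, volume (closedBall (c x) (τ x)) := by
    calc volume G ≤ volume (⋃ x ∈ U, closedBall (c x) (5 * τ x)) := measure_mono hcover
      _ ≤ ∑' x : U, volume (closedBall (c x) (5 * τ x)) :=
          measure_biUnion_le volume hUcount _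
      _ = ∑' x : U, ENNReal.ofReal (5 ^ (m + 1)) * volume (closedBall (c x) (τ x)) :=
          tsum_congr fun x => h5 x x.2
      _ = _ := ENNReal.tsum_mul_left
  have hdis : U.PairwiseDisjoint fun x => closedBall (c x) (τ x) \ E :=
    hUd.mono fun x => sdiff_subset
  have hsum2 : ENNReal.ofReal ε * ∑' x : U, volume (closedBall (c x) (τ x)) ≤
      volume (E' \ E) := by
    calc ENNReal.ofReal ε * ∑' x : U, volume (closedBall (c x) (τ x))
        = ∑' x : U, ENNReal.ofReal ε * volume (closedBall (c x) (τ x)) :=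
          ENNReal.tsum_mul_left.symm
      _ ≤ ∑' x : U, volume (closedBall (c x) (τ x) \ E) :=
          ENNReal.tsum_le_tsum fun x => hτm x (hUG x.2)
      _ = volume (⋃ x ∈ U, closedBall (c x) (τ x) \ E) :=
          (measure_biUnion hUcount hdis fun x _ => measurableSet_closedBall.diff hEm).symm
      _ ≤ volume (E' \ E) := measure_mono (iUnion₂_subset fun x hx =>
          sdiff_subset_sdiff_left (hτE x (hUG hx)))
  have h5pos : (0 : ℝ) < 5 ^ (m + 1) := by positivity
  refine le_trans ?_ hsum2
  calc ENNReal.ofReal (ε / 5 ^ (m + 1)) * volume G ≤ ENNReal.ofReal (ε / 5 ^ (m + 1)) *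
        (ENNReal.ofReal (5 ^ (m + 1)) * ∑' x : U, volume (closedBall (c x) (τ x))) := by
        gcongr
    _ = _ := by
        rw [← mul_assoc, ← ENNReal.ofReal_mul' (by positivity), div_mul_cancel₀ _ h5pos.ne']

/-- Covering ("ink spots") lemma: a set whose dense balls may be enlarged inside `E'` either has
`E'` covering the whole ball, or is enlarged by a fixed factor. -/
lemma ink_spots {x₀ : Spc m} {r ε : ℝ} (hr : 0 < r) (hε : 0 < ε) {E E' : Set (Spc m)}
    (hEm : MeasurableSet E) (hEs : E ⊆ closedBall x₀ r) (hEE' : E ⊆ E')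
    (hE : ∀ (y : Spc m) (t : ℝ), 0 < t → t ≤ r → closedBall y t ⊆ closedBall x₀ r →
      volume (closedBall y t \ E) < ENNReal.ofReal ε * volume (closedBall y t) →
      closedBall y (3 * t) ∩ closedBall x₀ r ⊆ E') :
    closedBall x₀ r ⊆ E' ∨
      (1 + ENNReal.ofReal (ε / 5 ^ (m + 1))) * volume E ≤ volume E' := by
  set c : Spc m → ℝ → Spc m := fun x t => x + (t / r) • (x₀ - x) with hc
  have hcx : ∀ x ∈ closedBall x₀ r, ∀ t, 0 < t → t ≤ r → dist (c x t) x₀ ≤ r - t := by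
    intro x hx t ht htr
    have e : c x t - x₀ = (1 - t / r) • (x - x₀) := by simp only [hc]; module
    have h1 : 0 ≤ 1 - t / r := by rw [sub_nonneg, div_le_one hr]; exact htr
    rw [dist_eq_norm, e, norm_smul, Real.norm_of_nonneg h1]
    calc (1 - t / r) * ‖x - x₀‖ ≤ (1 - t / r) * r := by
          gcongr; exact mem_closedBall_iff_norm.mp hx
      _ = r - t := by field_simp
  have hcd : ∀ x ∈ closedBall x₀ r, ∀ t₁ t₂, dist (c x t₁) (c x t₂) ≤ |t₁ - t₂| := by
    intro x hx t₁ t₂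
    have e : c x t₁ - c x t₂ = ((t₁ - t₂) / r) • (x₀ - x) := by simp only [hc]; module
    rw [dist_eq_norm, e, norm_smul, Real.norm_eq_abs, abs_div, abs_of_pos hr]
    calc |t₁ - t₂| / r * ‖x₀ - x‖ ≤ |t₁ - t₂| / r * r := by
          gcongr; rw [norm_sub_rev]; exact mem_closedBall_iff_norm.mp hx
      _ = |t₁ - t₂| := by field_simp
  have hc0 : ∀ x, c x 0 = x := fun x => by simp [hc]
  have hcsub : ∀ x ∈ closedBall x₀ r, ∀ t, 0 < t → t ≤ r →
      closedBall (c x t) t ⊆ closedBall x₀ r := fun x hx t ht htr =>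
    closedBall_subset_closedBall' (by linarith [hcx x hx t ht htr])
  have hxmem : ∀ x ∈ closedBall x₀ r, ∀ t, 0 < t → x ∈ closedBall (c x t) t := by
    intro x hx t ht
    have := hcd x hx 0 t
    rw [hc0, zero_sub, abs_neg, abs_of_pos ht] at this
    exact this
  set good : Spc m → ℝ → Prop := fun x t =>
    volume (closedBall (c x t) t \ E) < ENNReal.ofReal ε * volume (closedBall (c x t) t) with hgood
  by_cases hbig : ∃ x ∈ closedBall x₀ r, ∃ t, r / 2 < t ∧ t ≤ r ∧ good x t
  · obtain ⟨x, hx, t, ht1, ht2, hg⟩ := hbig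
    left
    have ht0 : 0 < t := by linarith
    refine fun y hy => hE (c x t) t ht0 ht2 (hcsub x hx t ht0 ht2) hg ⟨?_, hy⟩
    have h1 := hcx x hx t ht0 ht2
    have h2 := mem_closedBall.mp hy
    rw [mem_closedBall]
    linarith [dist_triangle y x₀ (c x t), dist_comm x₀ (c x t)]
  right
  push Not at hbig
  set G : Set (Spc m) := {x ∈ E | ∃ t, 0 < t ∧ t ≤ r / 2 ∧ good x t} with hG
  have hGE : volume E ≤ volume G := by
    refine measure_mono_ae ?_
    have hd := IsUnifLocDoublingMeasure.ae_tendsto_measure_inter_div volume E 1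
    rw [ae_restrict_iff' hEm] at hd
    filter_upwards [hd] with x hx hxE
    refine ⟨hxE, ?_⟩
    have hT : Tendsto (fun t : ℝ => t) (𝓝[>] 0) (𝓝[>] 0) := tendsto_id
    have h1 := hx hxE (fun t => c x t) (fun t => t) hT (by
      filter_upwards [self_mem_nhdsWithin] with t ht
      rw [one_mul]
      exact hxmem x (hEs hxE) t ht)
    have h2 := h1.add_const (ENNReal.ofReal ε)
    have h3 : (1 : ENNReal) < 1 + ENNReal.ofReal ε :=
      ENNReal.lt_add_right ENNReal.one_ne_top (by simpa using hε)
    have h4 := h2.eventually (lt_mem_nhds h3)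
    have h5 : ∀ᶠ t : ℝ in 𝓝[>] 0, t ≤ r / 2 :=
      eventually_nhdsWithin_of_eventually_nhds (ge_mem_nhds (by linarith))
    obtain ⟨t, ht, htr, ht0⟩ := (h4.and (h5.and self_mem_nhdsWithin)).exists
    have ht0 : 0 < t := ht0
    refine ⟨t, ht0, htr, ?_⟩
    by_contra hng
    have hng : ENNReal.ofReal ε * volume (closedBall (c x t) t) ≤
      volume (closedBall (c x t) t \ E) := not_lt.mp hng
    have hVpos : volume (closedBall (c x t) t) ≠ 0 := (measure_closedBall_pos volume _ ht0).ne'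
    have hVtop : volume (closedBall (c x t) t) ≠ ⊤ := measure_closedBall_lt_top.ne
    have hsum := measure_sdiff_add_inter (μ := volume) (closedBall (c x t) t) hEm
    have hle : volume (E ∩ closedBall (c x t) t) / volume (closedBall (c x t) t) +
        ENNReal.ofReal ε ≤ 1 := by
      have e : ENNReal.ofReal ε =
          ENNReal.ofReal ε * volume (closedBall (c x t) t) / volume (closedBall (c x t) t) := by
        rw [ENNReal.mul_div_cancel_right hVpos hVtop]
      rw [e, ENNReal.div_add_div_same, ENNReal.div_le_iff hVpos hVtop, one_mul]
      calc _ ≤ volume (E ∩ closedBall (c x t) t) + volume (closedBall (c x t) t \ E) := by gcongr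
        _ = _ := by rw [inter_comm, add_comm, hsum]
    exact absurd ht (not_lt.mpr hle)
  have hτ : ∀ x ∈ G, ∃ t, 0 < t ∧ t ≤ r ∧ closedBall (c x t) t ⊆ E' ∧
      ENNReal.ofReal ε * volume (closedBall (c x t) t) ≤ volume (closedBall (c x t) t \ E) := by
    rintro x ⟨hxE, hex⟩
    have hx := hEs hxE
    set T : Set ℝ := {t | 0 < t ∧ t ≤ r / 2 ∧ good x t} with hT
    have hTne : T.Nonempty := hex
    have hTb : BddAbove T := ⟨r / 2, fun t ht => ht.2.1⟩
    have hMpos : 0 < sSup T := by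
      obtain ⟨t, ht⟩ := hTne
      exact ht.1.trans_le (le_csSup hTb ht)
    obtain ⟨t, htT, ht⟩ := exists_lt_of_lt_csSup hTne (half_lt_self hMpos)
    have h2T : 2 * t ∉ T := fun h => by have := le_csSup hTb h; linarith
    have ht0 := htT.1
    have htr := htT.2.1
    refine ⟨2 * t, by linarith, by linarith, ?_, ?_⟩
    · intro y hy
      refine hE (c x t) t ht0 (by linarith) (hcsub x hx t ht0 (by linarith)) htT.2.2 ⟨?_,
        hcsub x hx (2 * t) (by linarith) (by linarith) hy⟩
      have h1 := hcd x hx (2 * t) t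
      rw [show 2 * t - t = t by ring, abs_of_pos ht0] at h1
      have h2 := mem_closedBall.mp hy
      rw [mem_closedBall]
      linarith [dist_triangle y (c x (2 * t)) (c x t)]
    · by_cases h : r / 2 < 2 * t
      · exact not_lt.mp (hbig x hx (2 * t) h (by linarith))
      · refine not_lt.mp fun hg => h2T ⟨by linarith, not_lt.mp h, hg⟩
  choose! τ hτ0 hτr hτE hτm using hτ
  have hfin : ENNReal.ofReal (ε / 5 ^ (m + 1)) * volume E ≤ volume (E' \ E) := by
    refine le_trans (by gcongr) (vitali_gain hEm (fun x => c x (τ x)) τ hτ0 hτr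
      (fun x hx => hxmem x (hEs hx.1) _ (hτ0 x hx)) hτE hτm)
  have hE'vol := measure_sdiff_add_inter (μ := volume) E' hEm
  rw [inter_eq_self_of_subset_right hEE'] at hE'vol
  rw [← hE'vol, add_mul, one_mul, add_comm]
  gcongr

lemma exists_barrier_exponent (m : ℕ) {lam Lam : ℝ} (hlam : 0 < lam) :
    ∃ q : ℕ, 1 ≤ q ∧ ((m : ℝ) + 1) * Lam < 2 * (q + 1) * lam := by
  obtain ⟨q, hq⟩ := exists_nat_gt (((m : ℝ) + 1) * Lam / (2 * lam))
  refine ⟨q + 1, by omega, ?_⟩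
  rw [div_lt_iff₀ (by positivity)] at hq
  push_cast
  nlinarith

/-- A nonnegative solution which is large on most of a ball is bounded below on the ball of triple
radius. -/
lemma exists_critical_density (m : ℕ) {lam Lam : ℝ} (hlam : 0 < lam) (hLam : lam ≤ Lam) :
    ∃ ε c : ℝ, 0 < ε ∧ 0 < c ∧ c ≤ 1 ∧
      ∀ A : Spc m → Matrix (Fin (m + 1)) (Fin (m + 1)) ℝ, IsElliptic lam Lam A →
      ∀ (u : Spc m → ℝ) (y : Spc m) (t s : ℝ), 0 < t → 0 < s →
        SolvesE A u (closedBall y (4 * t)) → (∀ x ∈ closedBall y (4 * t), 0 ≤ u x) →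
        volume (closedBall y t \ {x | s < u x}) < ENNReal.ofReal ε * volume (closedBall y t) →
        ∀ x ∈ closedBall y (3 * t), c * s < u x := by
  obtain ⟨ε, hε, H⟩ := exists_measure_estimate m hlam hLam
  obtain ⟨q, hq1, hq2⟩ := exists_barrier_exponent m (Lam := Lam) hlam
  set k : ℝ := (1 / 144) ^ q - (1 / 256) ^ q with hk
  have hkpos : 0 < k := by
    rw [hk, sub_pos]
    exact pow_lt_pow_left₀ (by norm_num) (by norm_num) (by omega)
  have hk1 : k ≤ 1 := by
    have h1 : ((1 : ℝ) / 144) ^ q ≤ 1 := pow_le_one₀ (by norm_num) (by norm_num)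
    have h2 : (0 : ℝ) ≤ (1 / 256) ^ q := by positivity
    linarith
  refine ⟨ε, k / 4, hε, by positivity, by linarith, ?_⟩
  intro A hA u y t s ht hs hu hu0 hvol
  have hsub1 : closedBall y t ⊆ closedBall y (4 * t) := closedBall_subset_closedBall (by linarith)
  have hsmall : ∀ x ∈ closedBall y (t / 4), s / 2 ≤ u x := by
    intro x hx
    by_contra! hlt
    have := H A hA u y x t (s / 2) ht (by positivity) (hu.mono hsub1)
      (fun z hz => hu0 z (hsub1 hz)) hx hlt.le
    refine absurd hvol (not_lt.mpr (this.trans (measure_mono fun z hz => ⟨hz.2, ?_⟩)))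
    have h1 : u z ≤ 2 * (s / 2) := hz.1
    have : ¬ s < u z := by linarith
    exact this
  intro x hx
  have hx3 : ‖x - y‖ ≤ 3 * t := mem_closedBall_iff_norm.mp hx
  by_cases hxs : ‖x - y‖ ≤ t / 4
  · have := hsmall x (mem_closedBall_iff_norm.mpr hxs)
    nlinarith
  · have hxs : t / 4 ≤ ‖x - y‖ := (not_le.mp hxs).le
    have := SolvesE.spread hlam hA hq1 hq2 (by positivity : 0 < t / 4)
      (by positivity : 0 < s / 2) hu hu0 hsmall hxs (by linarith)
    refine lt_of_lt_of_le ?_ this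
    have hxpos : 0 < ‖x - y‖ := by linarith
    have h1 : (((3 * t) ^ 2)⁻¹) ^ q ≤ ((‖x - y‖ ^ 2)⁻¹) ^ q := by gcongr
    have e1 : ((t / 4) ^ 2) ^ q * ((((3 * t) ^ 2)⁻¹) ^ q - (((4 * t) ^ 2)⁻¹) ^ q) = k := by
      rw [mul_sub, ← mul_pow, ← mul_pow, hk]
      congr 2 <;> (field_simp; norm_num)
    calc k / 4 * s < s / 2 * k := by nlinarith
      _ = s / 2 * ((t / 4) ^ 2) ^ q * ((((3 * t) ^ 2)⁻¹) ^ q - (((4 * t) ^ 2)⁻¹) ^ q) := by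
          rw [mul_assoc, e1]
      _ ≤ _ := by gcongr

/-- Growth lemma: a nonnegative solution which is large on a given proportion of a ball is bounded
below on the ball. -/
lemma exists_growth (m : ℕ) {lam Lam : ℝ} (hlam : 0 < lam) (hLam : lam ≤ Lam) {δ : ℝ}
    (hδ : 0 < δ) :
    ∃ c : ℝ, 0 < c ∧
      ∀ A : Spc m → Matrix (Fin (m + 1)) (Fin (m + 1)) ℝ, IsElliptic lam Lam A →
      ∀ (u : Spc m → ℝ) (x₀ : Spc m) (r s : ℝ), 0 < r → 0 < s →
        SolvesE A u (closedBall x₀ (5 * r)) → (∀ x ∈ closedBall x₀ (5 * r), 0 ≤ u x) →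
        ENNReal.ofReal δ * volume (closedBall x₀ r) ≤
          volume ({x | s < u x} ∩ closedBall x₀ r) →
        ∀ x ∈ closedBall x₀ r, c * s ≤ u x := by
  obtain ⟨ε, c, hε, hc0, hc1, H⟩ := exists_critical_density m hlam hLam
  set κ : ℝ := ε / 5 ^ (m + 1) with hκ
  have hκpos : 0 < κ := by positivity
  obtain ⟨N, hN⟩ := pow_unbounded_of_one_lt (1 / δ) (by linarith : 1 < 1 + κ)
  refine ⟨c ^ N, by positivity, ?_⟩
  intro A hA u x₀ r s hr hs hu hu0 hvol
  have hsub : closedBall x₀ r ⊆ closedBall x₀ (5 * r) := closedBall_subset_closedBall (by linarith)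
  set E : ℕ → Set (Spc m) := fun k => {x | c ^ k * s < u x} ∩ closedBall x₀ r with hEdef
  have hEm : ∀ k, MeasurableSet (E k) := fun k => by
    have h1 : IsClosed (closedBall x₀ r ∩ u ⁻¹' Iic (c ^ k * s)) :=
      (hu.continuousOn.mono hsub).preimage_isClosed_of_isClosed isClosed_closedBall isClosed_Iic
    have e : E k = closedBall x₀ r \ (closedBall x₀ r ∩ u ⁻¹' Iic (c ^ k * s)) := by
      ext x
      simp only [hEdef, mem_inter_iff, mem_ofPred_eq, Set.mem_sdiff, mem_preimage, mem_Iic, not_and,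
        not_le]
      exact ⟨fun h => ⟨h.2, fun _ => h.1⟩, fun h => ⟨h.2 h.1, h.1⟩⟩
    rw [e]
    exact measurableSet_closedBall.diff h1.measurableSet
  have hmono : ∀ k, E k ⊆ E (k + 1) := fun k x hx => by
    refine ⟨show c ^ (k + 1) * s < u x from lt_of_le_of_lt ?_ hx.1, hx.2⟩
    have : 0 < c ^ k * s := by positivity
    rw [pow_succ]; nlinarith
  have key : ∀ k, closedBall x₀ r ⊆ E k ∨
      (1 + ENNReal.ofReal κ) ^ k * volume (E 0) ≤ volume (E k) := by
    intro k
    induction k with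
    | zero => right; simp
    | succ k ih =>
      rcases ih with ih | ih
      · exact Or.inl (ih.trans (hmono k))
      · have := ink_spots hr hε (hEm k) inter_subset_right (hmono k) (by
          intro y t ht htr hyt hv x hx
          refine ⟨?_, hx.2⟩
          have hy : dist y x₀ ≤ r := hyt (mem_closedBall_self ht.le)
          have hs4 : closedBall y (4 * t) ⊆ closedBall x₀ (5 * r) :=
            closedBall_subset_closedBall' (by linarith)
          have hv' : volume (closedBall y t \ {x | c ^ k * s < u x}) <
              ENNReal.ofReal ε * volume (closedBall y t) := by
            have hsub' : closedBall y t \ {x | c ^ k * s < u x} ⊆ closedBall y t \ E k :=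
              fun z hz => ⟨hz.1, fun h => hz.2 h.1⟩
            exact lt_of_le_of_lt (measure_mono hsub') hv
          have := H A hA u y t (c ^ k * s) ht (by positivity) (hu.mono hs4)
            (fun z hz => hu0 z (hs4 hz)) hv' x hx.1
          change c ^ (k + 1) * s < u x
          rw [pow_succ']; linarith)
        rcases this with h | h
        · exact Or.inl h
        · right
          calc (1 + ENNReal.ofReal κ) ^ (k + 1) * volume (E 0)
              = (1 + ENNReal.ofReal κ) * ((1 + ENNReal.ofReal κ) ^ k * volume (E 0)) := by
                rw [pow_succ']; ring
            _ ≤ (1 + ENNReal.ofReal κ) * volume (E k) := by gcongr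
            _ ≤ _ := h
  have hfin : closedBall x₀ r ⊆ E N := by
    rcases key N with h | h
    · exact h
    · exfalso
      have hE0 : E 0 = {x | s < u x} ∩ closedBall x₀ r := by simp [hEdef]
      have hVpos : volume (closedBall x₀ r) ≠ 0 := (measure_closedBall_pos volume _ hr).ne'
      have hVtop : volume (closedBall x₀ r) ≠ ⊤ := measure_closedBall_lt_top.ne
      have h1 : (1 + ENNReal.ofReal κ) ^ N * (ENNReal.ofReal δ * volume (closedBall x₀ r)) ≤
          1 * volume (closedBall x₀ r) := by
        rw [one_mul]
        calc _ ≤ (1 + ENNReal.ofReal κ) ^ N * volume (E 0) := by rw [hE0]; gcongr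
          _ ≤ volume (E N) := h
          _ ≤ _ := measure_mono inter_subset_right
      rw [← mul_assoc, ENNReal.mul_le_mul_iff_left hVpos hVtop] at h1
      have e : (1 + ENNReal.ofReal κ) ^ N * ENNReal.ofReal δ =
          ENNReal.ofReal ((1 + κ) ^ N * δ) := by
        rw [ENNReal.ofReal_mul (by positivity), ENNReal.ofReal_pow (by positivity),
          ENNReal.ofReal_add zero_le_one hκpos.le, ENNReal.ofReal_one]
      rw [e, ENNReal.ofReal_le_one] at h1
      rw [div_lt_iff₀ hδ] at hN
      linarith
  exact fun x hx => (hfin hx).1.le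

/-- A nonnegative solution controls the value at the centre from a value `u₁` which almost
dominates it on a smaller ball. -/
lemma exists_harnack_center (m : ℕ) {lam Lam : ℝ} (hlam : 0 < lam) (hLam : lam ≤ Lam) :
    ∃ (q : ℕ) (κ c : ℝ), q ≠ 0 ∧ 0 < κ ∧ κ ≤ 1 / 8 ∧ (2 * q : ℕ) * κ ≤ 1 / 8 ∧ 0 < c ∧
      ∀ A : Spc m → Matrix (Fin (m + 1)) (Fin (m + 1)) ℝ, IsElliptic lam Lam A →
      ∀ (u : Spc m → ℝ) (x₀ x₁ : Spc m) (r d : ℝ), 0 < r → 0 < d → d ≤ r → dist x₁ x₀ ≤ r →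
        0 < u x₁ → SolvesE A u (closedBall x₀ (3 * r)) → (∀ x ∈ closedBall x₀ (3 * r), 0 ≤ u x) →
        (∀ x ∈ closedBall x₁ (κ * d), u x ≤ 3 / 2 * u x₁) →
        c * ((d ^ 2) ^ q * u x₁) ≤ (r ^ 2) ^ q * u x₀ := by
  obtain ⟨ε, hε, H⟩ := exists_measure_estimate m hlam hLam
  obtain ⟨q, hq1, hq2⟩ := exists_barrier_exponent m (Lam := Lam) hlam
  obtain ⟨c, hc, G⟩ := exists_growth m hlam hLam hε
  set κ : ℝ := 1 / (8 * (2 * q + 1)) with hκ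
  have hκ0 : 0 < κ := by positivity
  have hκ8 : κ ≤ 1 / 8 := by
    rw [hκ]; apply one_div_le_one_div_of_le (by norm_num)
    have : (0 : ℝ) ≤ q := by positivity
    linarith
  refine ⟨q, κ, c / 8 * (κ ^ 2) ^ q, by omega, hκ0, hκ8, ?_, by positivity, ?_⟩
  · rw [hκ]; push_cast
    rw [mul_one_div, div_le_div_iff₀ (by positivity) (by norm_num)]
    linarith
  intro A hA u x₀ x₁ r d hr hd hdr hx₁ hu₁ hu hu0 hle
  set ρ : ℝ := κ * d with hρ
  have hρ0 : 0 < ρ := by positivity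
  have hρr : ρ ≤ r / 8 := by nlinarith
  have hsub : ∀ t ≤ 2 * r, closedBall x₁ t ⊆ closedBall x₀ (3 * r) := fun t ht =>
    closedBall_subset_closedBall' (by linarith)
  have hV : SolvesE A (fun y => (-1) * u y + 3 / 2 * u x₁) (closedBall x₁ ρ) :=
    (hu.mono (hsub ρ (by linarith))).affine (-1) (3 / 2 * u x₁)
  have hmeas := H A hA (fun y => (-1) * u y + 3 / 2 * u x₁) x₁ x₁ ρ (u x₁ / 2) hρ0 (by positivity)
    hV (fun x hx => by have := hle x hx; linarith) (mem_closedBall_self (by positivity))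
    (by linarith)
  have hset : {x | (-1) * u x + 3 / 2 * u x₁ ≤ 2 * (u x₁ / 2)} ∩ closedBall x₁ ρ ⊆
      {x | u x₁ / 4 < u x} ∩ closedBall x₁ ρ := fun x hx => by
    refine ⟨?_, hx.2⟩
    have h1 : (-1) * u x + 3 / 2 * u x₁ ≤ 2 * (u x₁ / 2) := hx.1
    change u x₁ / 4 < u x
    linarith
  have hgrow := G A hA u x₁ ρ (u x₁ / 4) hρ0 (by positivity)
    (hu.mono (hsub _ (by linarith))) (fun x hx => hu0 x (hsub _ (by linarith) hx))
    (hmeas.trans (measure_mono hset))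
  set σ : ℝ := c * (u x₁ / 4) with hσ
  have hσ0 : 0 < σ := by positivity
  have hrq : (0 : ℝ) < (r ^ 2) ^ q := by positivity
  have key : σ * (ρ ^ 2) ^ q / 2 ≤ (r ^ 2) ^ q * u x₀ := by
    have hd0 : ‖x₀ - x₁‖ ≤ r := by rw [← dist_eq_norm, dist_comm]; exact hx₁
    by_cases hxρ : ρ ≤ ‖x₀ - x₁‖
    · have := SolvesE.spread hlam hA hq1 hq2 hρ0 hσ0 (hu.mono (hsub (2 * r) le_rfl))
        (fun x hx => hu0 x (hsub _ le_rfl hx)) hgrow hxρ (by linarith)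
      have hpos : 0 < ‖x₀ - x₁‖ := by linarith
      have h1 : ((r ^ 2)⁻¹) ^ q ≤ ((‖x₀ - x₁‖ ^ 2)⁻¹) ^ q := by gcongr
      have h2 : (((2 * r) ^ 2)⁻¹) ^ q ≤ ((r ^ 2)⁻¹) ^ q / 2 := by
        have e : ((2 * r) ^ 2)⁻¹ = (1 / 4) * (r ^ 2)⁻¹ := by rw [mul_pow, mul_inv]; norm_num
        have h4 : ((1 : ℝ) / 4) ^ q ≤ 1 / 2 := by
          calc ((1 : ℝ) / 4) ^ q ≤ (1 / 4) ^ 1 :=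
                pow_le_pow_of_le_one (by norm_num) (by norm_num) hq1
            _ ≤ 1 / 2 := by norm_num
        rw [e, mul_pow]
        have : (0 : ℝ) ≤ ((r ^ 2)⁻¹) ^ q := by positivity
        nlinarith
      have h3 : σ * (ρ ^ 2) ^ q * (((r ^ 2)⁻¹) ^ q / 2) ≤ u x₀ := by
        refine le_trans ?_ this
        gcongr
        linarith
      calc σ * (ρ ^ 2) ^ q / 2
          = (r ^ 2) ^ q * (σ * (ρ ^ 2) ^ q * (((r ^ 2)⁻¹) ^ q / 2)) := by
            rw [inv_pow]; field_simp
        _ ≤ _ := by gcongr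
    · have h1 : σ ≤ u x₀ := hgrow x₀ (mem_closedBall_iff_norm.mpr (not_le.mp hxρ).le)
      have h2 : (ρ ^ 2) ^ q ≤ (r ^ 2) ^ q := by gcongr; linarith
      have h3 : (0 : ℝ) ≤ (ρ ^ 2) ^ q := by positivity
      calc σ * (ρ ^ 2) ^ q / 2 ≤ (ρ ^ 2) ^ q * σ := by nlinarith
        _ ≤ (r ^ 2) ^ q * u x₀ := by gcongr
  calc c / 8 * (κ ^ 2) ^ q * ((d ^ 2) ^ q * u x₁) = σ * (ρ ^ 2) ^ q / 2 := by
        rw [hσ, hρ, mul_pow, mul_pow]; ring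
    _ ≤ _ := key

/-- Krylov–Safonov Harnack inequality. -/
lemma exists_harnack (m : ℕ) {lam Lam : ℝ} (hlam : 0 < lam) (hLam : lam ≤ Lam) :
    ∃ C : ℝ, 1 ≤ C ∧
      ∀ A : Spc m → Matrix (Fin (m + 1)) (Fin (m + 1)) ℝ, IsElliptic lam Lam A →
      ∀ (u : Spc m → ℝ) (x₀ : Spc m) (r : ℝ), 0 < r →
        SolvesE A u (closedBall x₀ (3 * r)) → (∀ x ∈ closedBall x₀ (3 * r), 0 ≤ u x) →
        ∀ y ∈ closedBall x₀ (r / 2), u y ≤ C * u x₀ := by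
  obtain ⟨q, κ, c, hq0, hκ0, hκ8, hκq, hc, H⟩ := exists_harnack_center m hlam hLam
  refine ⟨max 1 (4 ^ q / c), le_max_left _ _, ?_⟩
  intro A hA u x₀ r hr hu hu0 y hy
  have hsub : closedBall x₀ r ⊆ closedBall x₀ (3 * r) := closedBall_subset_closedBall (by linarith)
  set ψ : Spc m → ℝ := fun x => ((r - dist x x₀) ^ 2) ^ q * u x with hψ
  have hψc : ContinuousOn ψ (closedBall x₀ r) :=
    (by fun_prop : Continuous fun x : Spc m => ((r - dist x x₀) ^ 2) ^ q).continuousOn.mul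
      (hu.continuousOn.mono hsub)
  obtain ⟨x₁, hx₁, hmax⟩ := (isCompact_closedBall x₀ r).exists_isMaxOn
    ⟨x₀, mem_closedBall_self hr.le⟩ hψc
  have hmax : ∀ x ∈ closedBall x₀ r, ψ x ≤ ψ x₁ := hmax
  have hu00 : 0 ≤ u x₀ := hu0 x₀ (mem_closedBall_self (by linarith))
  have hrq : (0 : ℝ) < (r ^ 2) ^ q := by positivity
  have hy' : dist y x₀ ≤ r / 2 := hy
  have hyr : y ∈ closedBall x₀ r := mem_closedBall.mpr (by linarith)
  have hψy : (r ^ 2) ^ q * u y ≤ 4 ^ q * ψ y := by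
    have h1 : r ^ 2 ≤ 4 * (r - dist y x₀) ^ 2 := by nlinarith
    have h2 : (r ^ 2) ^ q ≤ 4 ^ q * ((r - dist y x₀) ^ 2) ^ q := by
      rw [← mul_pow]; gcongr
    have := hu0 y (hsub hyr)
    calc (r ^ 2) ^ q * u y ≤ 4 ^ q * ((r - dist y x₀) ^ 2) ^ q * u y := by gcongr
      _ = _ := by rw [hψ]; ring
  have key : c * ψ x₁ ≤ (r ^ 2) ^ q * u x₀ := by
    by_cases hpos : 0 < ψ x₁
    swap
    · have : ψ x₁ ≤ 0 := not_lt.mp hpos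
      nlinarith [mul_nonneg hrq.le hu00]
    have hu1 : 0 < u x₁ := by
      rcases (hu0 x₁ (hsub hx₁)).lt_or_eq with h | h
      · exact h
      · simp [hψ, ← h] at hpos
    have hdx : dist x₁ x₀ ≤ r := hx₁
    by_cases hd : dist x₁ x₀ < r
    · refine H A hA u x₀ x₁ r (r - dist x₁ x₀) hr (by linarith)
        (by linarith [dist_nonneg (x := x₁) (y := x₀)])
        hdx hu1 hu hu0 fun x hx => ?_
      set d := r - dist x₁ x₀ with hdd
      have hd0 : 0 < d := by linarith
      have hxd : dist x x₁ ≤ κ * d := hx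
      have h1 : (1 - κ) * d ≤ r - dist x x₀ := by
        linarith [dist_triangle x x₁ x₀]
      have hxr : x ∈ closedBall x₀ r := by
        rw [mem_closedBall]; nlinarith
      have h2 := hmax x hxr
      have h3 : 7 / 8 ≤ ((1 - κ) ^ 2) ^ q := by
        have := one_add_mul_le_pow (by linarith : (-2 : ℝ) ≤ -κ) (2 * q)
        rw [← pow_mul]
        rw [← sub_eq_add_neg] at this
        linarith
      have hux := hu0 x (hsub hxr)
      have h4 : ((1 - κ) ^ 2) ^ q * (d ^ 2) ^ q ≤ ((r - dist x x₀) ^ 2) ^ q := by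
        rw [← mul_pow, ← mul_pow]
        have : 0 ≤ (1 - κ) * d := by nlinarith
        gcongr
      have hdq : (0 : ℝ) < (d ^ 2) ^ q := by positivity
      have h5 : (d ^ 2) ^ q * (7 / 8 * u x) ≤ (d ^ 2) ^ q * u x₁ := by
        calc (d ^ 2) ^ q * (7 / 8 * u x) = 7 / 8 * (d ^ 2) ^ q * u x := by ring
          _ ≤ ((1 - κ) ^ 2) ^ q * (d ^ 2) ^ q * u x := by gcongr
          _ ≤ ((r - dist x x₀) ^ 2) ^ q * u x := by gcongr
          _ ≤ _ := h2
      have h6 := le_of_mul_le_mul_left h5 hdq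
      linarith
    · have hd : dist x₁ x₀ = r := le_antisymm hdx (not_lt.mp hd)
      simp [hψ, hd, hq0] at hpos
  have h1 : (r ^ 2) ^ q * u y ≤ (r ^ 2) ^ q * (4 ^ q / c * u x₀) := by
    calc (r ^ 2) ^ q * u y ≤ 4 ^ q * ψ y := hψy
      _ ≤ 4 ^ q * ψ x₁ := by gcongr; exact hmax y hyr
      _ = 4 ^ q / c * (c * ψ x₁) := by field_simp
      _ ≤ 4 ^ q / c * ((r ^ 2) ^ q * u x₀) := by gcongr
      _ = _ := by ring
  calc u y ≤ 4 ^ q / c * u x₀ := le_of_mul_le_mul_left h1 hrq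
    _ ≤ _ := by gcongr; exact le_max_right _ _

/-- Height of `x` above the graph of `g`. -/
def dep (g : Spc' m → ℝ) (x : Spc m) : ℝ := xlast x - g (xprime x)

/-- The point at height `t` above the graph of `g` over `p`. -/
def graphPt (g : Spc' m → ℝ) (p : Spc' m) (t : ℝ) : Spc m :=
  WithLp.toLp 2 (Fin.snoc (α := fun _ => ℝ) p.ofLp (g p + t))

lemma xprime_apply (x : Spc m) (i : Fin m) : xprime x i = x i.castSucc := rfl

lemma norm_sq_eq_xprime_xlast (x : Spc m) : ‖x‖ ^ 2 = ‖xprime x‖ ^ 2 + xlast x ^ 2 := by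
  rw [EuclideanSpace.norm_sq_eq, EuclideanSpace.norm_sq_eq, Fin.sum_univ_castSucc]
  simp [xprime_apply, xlast]

lemma xprime_sub (x y : Spc m) : xprime (x - y) = xprime x - xprime y := by
  ext i; simp [xprime_apply]

lemma xlast_sub (x y : Spc m) : xlast (x - y) = xlast x - xlast y := by simp [xlast]

lemma norm_xprime_sub_le (x y : Spc m) : ‖xprime x - xprime y‖ ≤ dist x y := by
  rw [← xprime_sub, dist_eq_norm]
  have := norm_sq_eq_xprime_xlast (x - y)
  exact abs_le_of_sq_le_sq' (by nlinarith [sq_nonneg (xlast (x - y))]) (norm_nonneg _) |>.2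

lemma abs_xlast_sub_le (x y : Spc m) : |xlast x - xlast y| ≤ dist x y := by
  rw [← xlast_sub, dist_eq_norm]
  have := norm_sq_eq_xprime_xlast (x - y)
  exact abs_le_of_sq_le_sq (by nlinarith [sq_nonneg ‖xprime (x - y)‖]) (norm_nonneg _)

lemma dist_le_xprime_xlast (x y : Spc m) :
    dist x y ≤ ‖xprime x - xprime y‖ + |xlast x - xlast y| := by
  rw [← xprime_sub, ← xlast_sub, dist_eq_norm]
  have h := norm_sq_eq_xprime_xlast (x - y)
  rw [← sq_abs (xlast (x - y))] at h
  refine abs_le_of_sq_le_sq' ?_ (by positivity) |>.2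
  nlinarith [mul_nonneg (norm_nonneg (xprime (x - y))) (abs_nonneg (xlast (x - y)))]

@[simp] lemma xprime_graphPt (g : Spc' m → ℝ) (p : Spc' m) (t : ℝ) :
    xprime (graphPt g p t) = p := by
  ext i; simp [xprime_apply, graphPt]

@[simp] lemma xlast_graphPt (g : Spc' m → ℝ) (p : Spc' m) (t : ℝ) :
    xlast (graphPt g p t) = g p + t := by
  simp [xlast, graphPt]

@[simp] lemma dep_graphPt (g : Spc' m → ℝ) (p : Spc' m) (t : ℝ) :
    dep g (graphPt g p t) = t := by
  simp [dep]

lemma eq_of_xprime_xlast {x y : Spc m} (h1 : xprime x = xprime y) (h2 : xlast x = xlast y) :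
    x = y := by
  have := dist_le_xprime_xlast x y
  rw [h1, h2, sub_self, sub_self, norm_zero, abs_zero, add_zero] at this
  exact dist_le_zero.mp this

lemma graphPt_self (g : Spc' m → ℝ) (x : Spc m) : graphPt g (xprime x) (dep g x) = x :=
  eq_of_xprime_xlast (by simp) (by simp [dep])

lemma dist_graphPt_vert (g : Spc' m → ℝ) (p : Spc' m) (s t : ℝ) :
    dist (graphPt g p s) (graphPt g p t) = |s - t| := by
  rw [dist_eq_norm, ← abs_of_nonneg (norm_nonneg (graphPt g p s - graphPt g p t)),
    ← sq_eq_sq_iff_abs_eq_abs, norm_sq_eq_xprime_xlast, xprime_sub, xlast_sub]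
  simp

lemma dist_graphPt_le {g : Spc' m → ℝ} {K : ℝ} (hg : ∀ x' y', |g x' - g y'| ≤ K * ‖x' - y'‖)
    (p p' : Spc' m) (s t : ℝ) :
    dist (graphPt g p s) (graphPt g p' t) ≤ (1 + K) * ‖p - p'‖ + |s - t| := by
  have h1 := dist_le_xprime_xlast (graphPt g p s) (graphPt g p' t)
  simp only [xprime_graphPt, xlast_graphPt] at h1
  have h2 : |g p + s - (g p' + t)| ≤ |g p - g p'| + |s - t| := by
    rw [show g p + s - (g p' + t) = (g p - g p') + (s - t) by ring]
    exact abs_add_le _ _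
  linarith [hg p p']

lemma abs_dep_sub_le {g : Spc' m → ℝ} {K : ℝ} (hK : 0 < K)
    (hg : ∀ x' y', |g x' - g y'| ≤ K * ‖x' - y'‖) (x y : Spc m) :
    |dep g x - dep g y| ≤ (1 + K) * dist x y := by
  have e : dep g x - dep g y = (xlast x - xlast y) - (g (xprime x) - g (xprime y)) := by
    simp only [dep]; ring
  rw [e]
  have h1 := abs_sub (xlast x - xlast y) (g (xprime x) - g (xprime y))
  have h2 := hg (xprime x) (xprime y)
  have h3 := norm_xprime_sub_le x y
  have h4 := abs_xlast_sub_le x y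
  nlinarith

lemma continuous_xprime : Continuous (xprime : Spc m → Spc' m) :=
  LipschitzWith.continuous (K := 1) (LipschitzWith.of_dist_le_mul fun x y => by
    simpa [dist_eq_norm] using norm_xprime_sub_le x y)

lemma continuous_dep {g : Spc' m → ℝ} {K : ℝ} (hK : 0 < K)
    (hg : ∀ x' y', |g x' - g y'| ≤ K * ‖x' - y'‖) : Continuous (dep g) :=
  LipschitzWith.continuous (K := ⟨1 + K, by positivity⟩) (LipschitzWith.of_dist_le_mul fun x y => by
    rw [Real.dist_eq]; exact abs_dep_sub_le hK hg x y)

lemma mem_CylE_iff (g : Spc' m → ℝ) (r : ℝ) (x : Spc m) :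
    x ∈ CylE g r ↔ ‖xprime x‖ < r ∧ 0 < dep g x ∧ dep g x < r := by
  simp only [CylE, mem_ofPred_eq, dep, sub_pos, sub_lt_iff_lt_add']

/-- A ball whose centre is deep enough lies in the cylinder. -/
lemma closedBall_subset_CylE {g : Spc' m → ℝ} {K : ℝ} (hK : 0 < K)
    (hg : ∀ x' y', |g x' - g y'| ≤ K * ‖x' - y'‖) {x : Spc m} {t r : ℝ}
    (h1 : ‖xprime x‖ + t < r) (h2 : (1 + K) * t < dep g x) (h3 : dep g x + (1 + K) * t < r) :
    closedBall x t ⊆ CylE g r := fun y hy => by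
  have hy : dist y x ≤ t := hy
  have h4 := abs_le.mp (abs_dep_sub_le hK hg y x)
  have h5 := norm_xprime_sub_le y x
  have h6 := norm_sub_norm_le (xprime y) (xprime x)
  have h7 : (1 + K) * dist y x ≤ (1 + K) * t := by gcongr
  rw [mem_CylE_iff]
  exact ⟨by linarith, by linarith, by linarith⟩

lemma CylE_one_eventually {g : Spc' m → ℝ} {K : ℝ} (hK : 0 < K)
    (hg : ∀ x' y', |g x' - g y'| ≤ K * ‖x' - y'‖) {z : Spc m} (hz : dep g z = 0)
    (hz' : ‖xprime z‖ < 1) : ∀ᶠ y in 𝓝[{y | 0 < dep g y}] z, y ∈ CylE g 1 := by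
  have h1 : ∀ᶠ y in 𝓝 z, ‖xprime y‖ < 1 :=
    (continuous_xprime.norm.tendsto z).eventually (gt_mem_nhds hz')
  have h2 : ∀ᶠ y in 𝓝 z, dep g y < 1 :=
    ((continuous_dep hK hg).tendsto z).eventually (gt_mem_nhds (by rw [hz]; norm_num))
  filter_upwards [eventually_nhdsWithin_of_eventually_nhds h1,
    eventually_nhdsWithin_of_eventually_nhds h2, self_mem_nhdsWithin] with y a b c
  exact (mem_CylE_iff g 1 y).mpr ⟨a, c, b⟩

/-- Points of the graph over the unit ball are limits of points above the graph. -/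
lemma neBot_above {g : Spc' m → ℝ} {z : Spc m} (hz : dep g z = 0) :
    (𝓝[{y | 0 < dep g y}] z).NeBot := by
  rw [← mem_closure_iff_nhdsWithin_neBot, Metric.mem_closure_iff]
  intro ε hε
  refine ⟨graphPt g (xprime z) (ε / 2), ?_, ?_⟩
  · change 0 < dep g _
    rw [dep_graphPt]; positivity
  · have h := dist_graphPt_vert g (xprime z) (dep g z) (ε / 2)
    rw [graphPt_self, hz, zero_sub, abs_neg, abs_of_pos (by positivity)] at h
    rw [h]
    linarith

lemma VanishesOnE.tendsto_above {g : Spc' m → ℝ} {K : ℝ} (hK : 0 < K)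
    (hg : ∀ x' y', |g x' - g y'| ≤ K * ‖x' - y'‖) {w : Spc m → ℝ}
    (hw : VanishesOnE w (CylE g 1) (graphSetE g)) {z : Spc m} (hz : dep g z = 0)
    (hz' : ‖xprime z‖ < 1) : Tendsto w (𝓝[{y | 0 < dep g y}] z) (𝓝 0) := by
  have hle : 𝓝[{y | 0 < dep g y}] z ≤ 𝓝[CylE g 1] z :=
    le_inf nhdsWithin_le_nhds (le_principal_iff.mpr (CylE_one_eventually hK hg hz hz'))
  have := neBot_above hz
  refine (hw z ⟨sub_eq_zero.mp hz, mem_closure_iff_nhdsWithin_neBot.mpr (this.mono hle)⟩).mono_left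
    hle

lemma VanishesOnE.comb {g : Spc' m → ℝ} {u v : Spc m → ℝ}
    (hu : VanishesOnE u (CylE g 1) (graphSetE g)) (hv : VanishesOnE v (CylE g 1) (graphSetE g))
    (a b : ℝ) : VanishesOnE (fun y => a * u y + b * v y + 0) (CylE g 1) (graphSetE g) :=
  fun z hz => by
    simpa using (((hu z hz).const_mul a).add ((hv z hz).const_mul b)).add_const 0

/-- Harnack inequality with constant `C` on all balls whose sixfold enlargement lies in `Ω`. -/
def HarnackOn (C : ℝ) (u : Spc m → ℝ) (Ω : Set (Spc m)) : Prop :=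
  ∀ (x : Spc m) (r : ℝ), 0 < r → closedBall x (3 * r) ⊆ Ω → ∀ y ∈ closedBall x (r / 2),
    u y ≤ C * u x

lemma exists_harnackOn (m : ℕ) {lam Lam : ℝ} (hlam : 0 < lam) (hLam : lam ≤ Lam) :
    ∃ C : ℝ, 1 ≤ C ∧
      ∀ A : Spc m → Matrix (Fin (m + 1)) (Fin (m + 1)) ℝ, IsElliptic lam Lam A →
      ∀ (u : Spc m → ℝ) (Ω : Set (Spc m)), SolvesE A u Ω → (∀ x ∈ Ω, 0 ≤ u x) →
        HarnackOn C u Ω := by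
  obtain ⟨C, hC, H⟩ := exists_harnack m hlam hLam
  exact ⟨C, hC, fun A hA u Ω hu hu0 x r hr hsub =>
    H A hA u x r hr (hu.mono hsub) fun y hy => hu0 y (hsub hy)⟩

/-- Harnack inequality along a Lipschitz path. -/
lemma harnack_chain {C : ℝ} (hC : 1 ≤ C) {Ω : Set (Spc m)} {u : Spc m → ℝ}
    (H : HarnackOn C u Ω)
    {γ : ℝ → Spc m} {ℓ r : ℝ} (hr : 0 < r) (hγ : ∀ s ∈ Icc (0 : ℝ) 1, ∀ t ∈ Icc (0 : ℝ) 1,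
      dist (γ s) (γ t) ≤ ℓ * |s - t|)
    (hγΩ : ∀ s ∈ Icc (0 : ℝ) 1, closedBall (γ s) (3 * r) ⊆ Ω) {N : ℕ} (hN : ℓ ≤ N * (r / 2))
    (hN0 : N ≠ 0) :
    u (γ 1) ≤ C ^ N * u (γ 0) := by
  have hNpos : (0 : ℝ) < N := by positivity
  have key : ∀ k : ℕ, k ≤ N → u (γ (k / N)) ≤ C ^ k * u (γ 0) := by
    intro k
    induction k with
    | zero => intro _; simp
    | succ k ih =>
      intro hk
      have hk' : ((k + 1 : ℕ) : ℝ) ≤ N := by exact_mod_cast hk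
      push_cast at hk'
      have h1 : (k : ℝ) / N ∈ Icc (0 : ℝ) 1 :=
        ⟨by positivity, by rw [div_le_one hNpos]; linarith⟩
      have h2 : ((k : ℝ) + 1) / N ∈ Icc (0 : ℝ) 1 :=
        ⟨by positivity, by rw [div_le_one hNpos]; linarith⟩
      have h3 := H _ r hr (hγΩ _ h1) (γ (((k : ℝ) + 1) / N)) (by
        refine (hγ _ h2 _ h1).trans ?_
        rw [← sub_div, add_sub_cancel_left, abs_of_pos (by positivity), mul_one_div,
          div_le_iff₀ hNpos]
        linarith)
      push_cast
      calc _ ≤ C * u (γ (k / N)) := h3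
        _ ≤ C * (C ^ k * u (γ 0)) := by gcongr; exact ih (by omega)
        _ = _ := by ring
  have := key N le_rfl
  rwa [div_self hNpos.ne'] at this

/-- A solution with nonnegative boundary values on the graph and lower bound `-b` near the graph
improves its lower bound by a fixed factor at comparable height. -/
lemma exists_boundary_decay (m : ℕ) {lam Lam K : ℝ} (hlam : 0 < lam) (hK : 0 < K) :
    ∃ c : ℝ, 0 < c ∧ c < 1 ∧
      ∀ A : Spc m → Matrix (Fin (m + 1)) (Fin (m + 1)) ℝ, IsElliptic lam Lam A →
      ∀ g : Spc' m → ℝ, (∀ x' y', |g x' - g y'| ≤ K * ‖x' - y'‖) →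
      ∀ (w : Spc m → ℝ) (x : Spc m) (s b : ℝ), 0 < s → 0 < b → 0 < dep g x → dep g x ≤ s →
        SolvesE A w ({y | 0 < dep g y} ∩ ball x (8 * s)) →
        (∀ y ∈ ball x (8 * s), 0 < dep g y → -b ≤ w y) →
        (∀ z ∈ ball x (8 * s), dep g z = 0 →
          ∀ ε > 0, ∀ᶠ y in 𝓝[{y | 0 < dep g y}] z, -ε < w y) →
        -((1 - c) * b) ≤ w x := by
  obtain ⟨q, hq1, hq2⟩ := exists_barrier_exponent m (Lam := Lam) hlam
  set L : ℝ := 1 + K with hL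
  have hL1 : 1 < L := by linarith
  have hLq : (0 : ℝ) < ((L ^ 2)⁻¹) ^ q := by positivity
  have hLq1 : ((L ^ 2)⁻¹) ^ q ≤ 1 :=
    pow_le_one₀ (by positivity) (inv_le_one_of_one_le₀ (one_le_pow₀ hL1.le))
  have h916 : ((1 : ℝ) / 16) ^ q < (1 / 9) ^ q :=
    pow_lt_pow_left₀ (by norm_num) (by norm_num) (by omega)
  have h9 : ((1 : ℝ) / 9) ^ q ≤ 1 := pow_le_one₀ (by norm_num) (by norm_num)
  have h16 : (0 : ℝ) < (1 / 16) ^ q := by positivity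
  refine ⟨((L ^ 2)⁻¹) ^ q * ((1 / 9) ^ q - (1 / 16) ^ q), by nlinarith, by nlinarith, ?_⟩
  intro A hA g hg w x s b hs hb hx0 hxs hw hwb hwΓ
  have hdc := continuous_dep hK hg
  set x₀ : Spc m := graphPt g (xprime x) (dep g x - 3 * s) with hx₀
  have hdx : dist x x₀ = 3 * s := by
    have h := dist_graphPt_vert g (xprime x) (dep g x) (dep g x - 3 * s)
    rw [graphPt_self] at h
    rw [h, sub_sub_cancel, abs_of_pos (by positivity)]
  have hd0 : dep g x₀ ≤ -(2 * s) := by rw [hx₀, dep_graphPt]; linarith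
  set ρ : ℝ := s / L with hρ
  have hρ0 : 0 < ρ := by positivity
  have hfar : ∀ y : Spc m, 0 ≤ dep g y → ρ ≤ ‖y - x₀‖ := by
    intro y hy
    have h1 := (abs_le.mp (abs_dep_sub_le hK hg y x₀)).2
    rw [hρ, div_le_iff₀ (by positivity), ← dist_eq_norm]
    nlinarith
  set S : Set (Spc m) := {y | 0 < dep g y} ∩ ball x₀ (4 * s) with hS
  have hS8 : S ⊆ {y | 0 < dep g y} ∩ ball x (8 * s) := fun y hy => by
    have h1 : dist y x₀ < 4 * s := hy.2
    refine ⟨hy.1, ?_⟩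
    rw [mem_ball]
    linarith [dist_triangle y x₀ x, dist_comm x x₀]
  have hSo : IsOpen S := (isOpen_lt continuous_const hdc).inter isOpen_ball
  have hx₀S : x₀ ∉ S := fun h => by
    have : 0 < dep g x₀ := h.1
    linarith
  set a : ℝ := b * (ρ ^ 2) ^ q with ha
  have ha0 : 0 < a := by positivity
  set κ : ℝ := a * (((4 * s) ^ 2)⁻¹) ^ q with hκ
  have hκ0 : 0 < κ := by positivity
  have hbar_le : ∀ y : Spc m, 0 ≤ dep g y → a * powBar q x₀ y ≤ b := by
    intro y hy
    have h1 := hfar y hy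
    have h2 : powBar q x₀ y ≤ ((ρ ^ 2)⁻¹) ^ q := by
      unfold powBar; gcongr
    calc a * powBar q x₀ y ≤ a * ((ρ ^ 2)⁻¹) ^ q := by gcongr
      _ = b := by rw [ha, inv_pow]; field_simp
  have hmain := SolvesE.barrier_le hlam hA hq1 hq2 hSo (isBounded_ball.subset inter_subset_right)
    (hw.mono hS8) hx₀S ha0 (b := -b - κ) (fun z hz hzS ε hε => by
      have hsub : S ⊆ {y | 0 ≤ dep g y} ∩ closedBall x₀ (4 * s) := fun y hy =>
        ⟨le_of_lt (show 0 < dep g y from hy.1), ball_subset_closedBall hy.2⟩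
      have hcl : z ∈ {y | 0 ≤ dep g y} ∩ closedBall x₀ (4 * s) :=
        closure_minimal hsub ((isClosed_le continuous_const hdc).inter isClosed_closedBall) hz
      have hz0 : 0 ≤ dep g z := hcl.1
      rcases hz0.eq_or_lt with h0 | h0
      · have hz8 : z ∈ ball x (8 * s) := by
          have : dist z x₀ ≤ 4 * s := hcl.2
          rw [mem_ball]
          linarith [dist_triangle z x₀ x, dist_comm x x₀]
        have h1 := (hwΓ z hz8 h0.symm ε hε).filter_mono
          (nhdsWithin_mono z (inter_subset_left : S ⊆ _))
        filter_upwards [h1, self_mem_nhdsWithin] with y hy hyS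
        have := hbar_le y (le_of_lt hyS.1)
        linarith
      · have hz4 : 4 * s ≤ ‖z - x₀‖ := by
          rw [← dist_eq_norm]
          by_contra! h
          exact hzS ⟨h0, h⟩
        have hzne : z ≠ x₀ := fun h => by
          rw [h, sub_self, norm_zero] at hz4; linarith
        have h1 : a * powBar q x₀ z ≤ κ := by
          rw [hκ]; unfold powBar; gcongr
        have h2 : Tendsto (fun y => a * powBar q x₀ y) (𝓝[S] z) (𝓝 (a * powBar q x₀ z)) :=
          (((powBar_contDiffAt q hzne).continuousAt.tendsto).const_mul a).mono_left
            nhdsWithin_le_nhds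
        have h3 := h2.eventually (gt_mem_nhds (by linarith : a * powBar q x₀ z < κ + ε))
        filter_upwards [h3, self_mem_nhdsWithin] with y hy hyS
        have := hwb y (hS8 hyS).2 hyS.1
        linarith)
  have hxS : x ∈ S := ⟨hx0, by rw [mem_ball, hdx]; linarith⟩
  refine le_trans (le_of_eq ?_) (hmain x hxS)
  rw [hκ, powBar, ← dist_eq_norm, hdx, ha, hρ]
  have e1 : ((s / L) ^ 2) ^ q * (((3 * s) ^ 2)⁻¹) ^ q = ((L ^ 2)⁻¹) ^ q * (1 / 9) ^ q := by
    rw [← mul_pow, ← mul_pow]; congr 1; field_simp; norm_num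
  have e2 : ((s / L) ^ 2) ^ q * (((4 * s) ^ 2)⁻¹) ^ q = ((L ^ 2)⁻¹) ^ q * (1 / 16) ^ q := by
    rw [← mul_pow, ← mul_pow]; congr 1; field_simp; norm_num
  rw [mul_assoc b, e1, mul_assoc b, e2]
  ring

/-- Values at points of definite height are comparable to the value at the reference point. -/
lemma exists_interior_bound (m : ℕ) {K C c₀ : ℝ} (hK : 0 < K) (hC : 1 ≤ C) (hc : 0 < c₀)
    (hc2 : c₀ ≤ 1 / 2) :
    ∃ C₀ : ℝ, 1 ≤ C₀ ∧ ∀ g : Spc' m → ℝ, (∀ x' y', |g x' - g y'| ≤ K * ‖x' - y'‖) →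
      ∀ u : Spc m → ℝ, HarnackOn C u (CylE g 1) →
      ∀ x : Spc m, ‖xprime x‖ ≤ 7 / 8 → c₀ ≤ dep g x → dep g x ≤ 1 / 2 →
        u x ≤ C₀ * u (graphPt g 0 (1 / 2)) ∧ u (graphPt g 0 (1 / 2)) ≤ C₀ * u x := by
  set L : ℝ := 1 + K with hL
  have hL1 : 1 < L := by linarith
  set r : ℝ := c₀ / (48 * L) with hr
  have hr0 : 0 < r := by positivity
  have hrL : L * (3 * r) = c₀ / 16 := by rw [hr]; field_simp; norm_num
  have hr3 : 3 * r ≤ c₀ / 16 := by nlinarith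
  obtain ⟨N, hN⟩ := exists_nat_gt (2 * L / (r / 2))
  have hN' : 2 * L ≤ N * (r / 2) := by
    rw [div_lt_iff₀ (by positivity)] at hN; exact hN.le
  have hN0 : N ≠ 0 := by
    rintro rfl
    rw [Nat.cast_zero, zero_mul] at hN'
    linarith
  refine ⟨C ^ N, one_le_pow₀ hC, ?_⟩
  intro g hg u H x hx hd1 hd2
  set γ : ℝ → Spc m := fun t =>
    graphPt g ((1 - t) • xprime x) ((1 - t) * dep g x + t * (1 / 2)) with hγ
  have hγ0 : γ 0 = x := by simp [hγ, graphPt_self]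
  have hγ1 : γ 1 = graphPt g 0 (1 / 2) := by simp [hγ]
  have hlip : ∀ s t, dist (γ s) (γ t) ≤ 2 * L * |s - t| := by
    intro s t
    have h1 := dist_graphPt_le hg ((1 - s) • xprime x) ((1 - t) • xprime x)
      ((1 - s) * dep g x + s * (1 / 2)) ((1 - t) * dep g x + t * (1 / 2))
    have e1 : ‖(1 - s) • xprime x - (1 - t) • xprime x‖ = |s - t| * ‖xprime x‖ := by
      rw [← sub_smul, norm_smul, Real.norm_eq_abs, abs_sub_comm]; congr 2; ring
    have e2 : |(1 - s) * dep g x + s * (1 / 2) - ((1 - t) * dep g x + t * (1 / 2))| =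
        |s - t| * |1 / 2 - dep g x| := by
      rw [← abs_mul]; congr 1; ring
    have h2 : |1 / 2 - dep g x| ≤ 1 := by rw [abs_le]; constructor <;> linarith
    have h3 : (1 + K) * (|s - t| * ‖xprime x‖) ≤ L * (|s - t| * 1) := by
      gcongr; linarith
    have h4 : |s - t| * |1 / 2 - dep g x| ≤ |s - t| * 1 := by gcongr
    rw [e1, e2] at h1
    nlinarith [abs_nonneg (s - t)]
  have hball : ∀ t ∈ Icc (0 : ℝ) 1, closedBall (γ t) (3 * r) ⊆ CylE g 1 := by
    rintro t ⟨ht0, ht1⟩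
    have h1 : ‖(1 - t) • xprime x‖ ≤ 7 / 8 := by
      rw [norm_smul, Real.norm_of_nonneg (by linarith)]
      nlinarith [norm_nonneg (xprime x)]
    refine closedBall_subset_CylE hK hg ?_ ?_ ?_ <;>
      simp only [hγ, xprime_graphPt, dep_graphPt] <;> nlinarith
  constructor
  · have := harnack_chain hC H hr0 (γ := fun t => γ (1 - t)) (ℓ := 2 * L)
      (fun s _ t _ => by
        have := hlip (1 - s) (1 - t)
        rwa [show 1 - s - (1 - t) = -(s - t) by ring, abs_neg] at this)
      (fun t ht => hball _ ⟨by linarith [ht.2], by linarith [ht.1]⟩) hN' hN0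
    simpa [hγ0, hγ1] using this
  · have := harnack_chain hC H hr0 (fun s _ t _ => hlip s t) hball hN' hN0
    rwa [hγ0, hγ1] at this

/-- Polynomial growth bound near the graph. -/
lemma exists_power_bound (m : ℕ) {K C : ℝ} (hK : 0 < K) (hC : 1 ≤ C) :
    ∃ (C₀ : ℝ) (p : ℕ), 1 ≤ C₀ ∧ p ≠ 0 ∧
      ∀ g : Spc' m → ℝ, (∀ x' y', |g x' - g y'| ≤ K * ‖x' - y'‖) →
      ∀ u : Spc m → ℝ, HarnackOn C u (CylE g 1) → u (graphPt g 0 (1 / 2)) = 1 →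
      ∀ x : Spc m, ‖xprime x‖ ≤ 7 / 8 → 0 < dep g x → dep g x ≤ 1 / 2 →
        u x ≤ C₀ * ((dep g x)⁻¹) ^ p := by
  obtain ⟨C₀, hC₀, hI⟩ := exists_interior_bound m hK hC (by norm_num : (0 : ℝ) < 1 / 4)
    (by norm_num)
  set L : ℝ := 1 + K with hL
  have hL1 : 1 < L := by linarith
  set θ : ℝ := 1 / (12 * L) with hθ
  have hθ0 : 0 < θ := by positivity
  have hθL : L * θ = 1 / 12 := by rw [hθ]; field_simp
  have hθ1 : θ ≤ 1 / 12 := by nlinarith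
  obtain ⟨p₀, hp₀⟩ := pow_unbounded_of_one_lt C (by linarith : 1 < 1 + θ)
  have hp : C ≤ (1 + θ) ^ (p₀ + 1) :=
    hp₀.le.trans (pow_le_pow_right₀ (by linarith) (by omega))
  set p := p₀ + 1 with hpdef
  refine ⟨C₀, p, hC₀, by omega, ?_⟩
  intro g hg u H hu1
  have hbase : ∀ x : Spc m, ‖xprime x‖ ≤ 7 / 8 → 1 / 4 ≤ dep g x → dep g x ≤ 1 / 2 →
      u x ≤ C₀ * ((dep g x)⁻¹) ^ p := by
    intro x hx h1 h2
    have h3 := (hI g hg u H x hx h1 h2).1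
    rw [hu1] at h3
    have h4 : 1 ≤ ((dep g x)⁻¹) ^ p := one_le_pow₀ (by rw [one_le_inv₀] <;> linarith)
    nlinarith
  have key : ∀ (k : ℕ) (x : Spc m), ‖xprime x‖ ≤ 7 / 8 → 0 < dep g x → dep g x ≤ 1 / 2 →
      1 / 4 ≤ dep g x * (1 + θ) ^ k → u x ≤ C₀ * ((dep g x)⁻¹) ^ p := by
    intro k
    induction k with
    | zero => intro x hx h0 h1 h2; exact hbase x hx (by simpa using h2) h1
    | succ k ih =>
      intro x hx h0 h1 h2
      by_cases h4 : 1 / 4 ≤ dep g x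
      · exact hbase x hx h4 h1
      have h4 : dep g x < 1 / 4 := not_le.mp h4
      set d := dep g x with hd
      set y : Spc m := graphPt g (xprime x) ((1 + θ) * d) with hy
      have hyd : dep g y = (1 + θ) * d := dep_graphPt _ _ _
      have hyx : xprime y = xprime x := xprime_graphPt _ _ _
      have hdy : dist x y = θ * d := by
        have h := dist_graphPt_vert g (xprime x) d ((1 + θ) * d)
        rw [graphPt_self] at h
        rw [h, show d - (1 + θ) * d = -(θ * d) by ring, abs_neg, abs_of_pos (by positivity)]
      have h5 := ih y (by rw [hyx]; exact hx) (by rw [hyd]; positivity)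
        (by rw [hyd]; nlinarith) (by rw [hyd]; calc
          1 / 4 ≤ d * (1 + θ) ^ (k + 1) := h2
          _ = _ := by ring)
      have h6 : L * (3 * (2 * (θ * d))) = d / 2 := by
        calc L * (3 * (2 * (θ * d))) = 6 * (L * θ) * d := by ring
          _ = _ := by rw [hθL]; ring
      have hθd : 0 < θ * d := by positivity
      have hθd2 : θ * d ≤ d / 12 := by nlinarith
      have h7 := H y (2 * (θ * d)) (by positivity)
        (closedBall_subset_CylE hK hg (by rw [hyx]; linarith) (by rw [hyd, h6]; nlinarith)
          (by rw [hyd, h6]; nlinarith)) x (by rw [mem_closedBall, hdy]; linarith)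
      calc u x ≤ C * u y := h7
        _ ≤ C * (C₀ * ((dep g y)⁻¹) ^ p) := by gcongr
        _ ≤ (1 + θ) ^ p * (C₀ * ((dep g y)⁻¹) ^ p) := by
            have : 0 < dep g y := by rw [hyd]; positivity
            gcongr
        _ = C₀ * ((dep g x)⁻¹) ^ p := by
            rw [hyd, ← hd, mul_inv, mul_pow, inv_pow (1 + θ)]; field_simp
  intro x hx h0 h1
  obtain ⟨k, hk⟩ := pow_unbounded_of_one_lt (1 / 4 / dep g x) (by linarith : 1 < 1 + θ)
  rw [div_lt_iff₀ h0] at hk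
  exact key k x hx h0 h1 (by linarith)

/-- Extension of `u` by zero below the graph is continuous where `u` vanishes on the graph. -/
lemma VanishesOnE.continuousOn_extend {g : Spc' m → ℝ} {K : ℝ} (hK : 0 < K)
    (hg : ∀ x' y', |g x' - g y'| ≤ K * ‖x' - y'‖) {u : Spc m → ℝ}
    (huc : ContinuousOn u (CylE g 1)) (hu : VanishesOnE u (CylE g 1) (graphSetE g)) :
    ContinuousOn (fun x => if 0 < dep g x then u x else 0)
      {x | ‖xprime x‖ < 1 ∧ dep g x < 1} := by
  have hdc := continuous_dep hK hg
  have hopen : IsOpen (CylE g 1) := by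
    have e : CylE g 1 = {x | ‖xprime x‖ < 1} ∩ ({x | 0 < dep g x} ∩ {x | dep g x < 1}) :=
      Set.ext fun x => mem_CylE_iff g 1 x
    rw [e]
    exact (isOpen_lt continuous_xprime.norm continuous_const).inter
      ((isOpen_lt continuous_const hdc).inter (isOpen_lt hdc continuous_const))
  rintro x ⟨hx1, hx2⟩
  refine ContinuousAt.continuousWithinAt ?_
  rcases lt_trichotomy 0 (dep g x) with h | h | h
  · have hx : x ∈ CylE g 1 := (mem_CylE_iff g 1 x).mpr ⟨hx1, h, hx2⟩
    refine (huc.continuousAt (hopen.mem_nhds hx)).congr ?_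
    filter_upwards [(isOpen_lt continuous_const hdc).mem_nhds h] with y hy
    rw [if_pos hy]
  · have h1 := hu.tendsto_above hK hg h.symm hx1
    rw [ContinuousAt, if_neg (by rw [← h]; exact lt_irrefl _)]
    refine Tendsto.if ?_ tendsto_const_nhds
    exact h1
  · have : ContinuousAt (fun _ : Spc m => (0 : ℝ)) x := continuousAt_const
    refine this.congr ?_
    filter_upwards [(isOpen_lt hdc continuous_const).mem_nhds h] with y hy
    rw [if_neg (not_lt.mpr (le_of_lt hy))]

lemma isCompact_closed_cylinder {g : Spc' m → ℝ} {K : ℝ} (hK : 0 < K)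
    (hg : ∀ x' y', |g x' - g y'| ≤ K * ‖x' - y'‖) (a b : ℝ) :
    IsCompact {x : Spc m | ‖xprime x‖ ≤ a ∧ 0 ≤ dep g x ∧ dep g x ≤ b} := by
  have hdc := continuous_dep hK hg
  refine Metric.isCompact_of_isClosed_isBounded ?_ ?_
  · exact (isClosed_le continuous_xprime.norm continuous_const).inter
      ((isClosed_le continuous_const hdc).inter (isClosed_le hdc continuous_const))
  · refine (Metric.isBounded_closedBall (x := graphPt g 0 0) (r := (1 + K) * a + b)).subset ?_
    rintro x ⟨h1, h2, h3⟩
    have h := dist_graphPt_le hg (xprime x) 0 (dep g x) 0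
    rw [graphPt_self, sub_zero, sub_zero, abs_of_nonneg h2] at h
    rw [mem_closedBall]
    have : (1 + K) * ‖xprime x‖ ≤ (1 + K) * a := by gcongr
    linarith

/-- Carleson estimate: a normalized positive solution vanishing on the graph is bounded up to the
graph. -/
lemma exists_carleson (m : ℕ) {lam Lam K : ℝ} (hlam : 0 < lam) (hLam : lam ≤ Lam) (hK : 0 < K) :
    ∃ C₁ : ℝ, 1 ≤ C₁ ∧
      ∀ A : Spc m → Matrix (Fin (m + 1)) (Fin (m + 1)) ℝ, IsElliptic lam Lam A →
      ∀ g : Spc' m → ℝ, (∀ x' y', |g x' - g y'| ≤ K * ‖x' - y'‖) →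
      ∀ u : Spc m → ℝ, SolvesE A u (CylE g 1) → (∀ x ∈ CylE g 1, 0 < u x) →
        VanishesOnE u (CylE g 1) (graphSetE g) → u (graphPt g 0 (1 / 2)) = 1 →
        ∀ x : Spc m, ‖xprime x‖ ≤ 3 / 4 → 0 < dep g x → dep g x ≤ 1 / 2 → u x ≤ C₁ := by
  obtain ⟨C, hC, hharn⟩ := exists_harnackOn m hlam hLam
  obtain ⟨C₀, p, hC₀, hp0, hpow⟩ := exists_power_bound m hK hC
  obtain ⟨c, hc0, hc1, hdecay⟩ := exists_boundary_decay m (Lam := Lam) hlam hK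
  set L : ℝ := 1 + K with hL
  have hL1 : 1 < L := by linarith
  have hppos : (0 : ℝ) < p := by positivity
  obtain ⟨κ, hκ0, hκ1, hκ2⟩ : ∃ κ : ℝ, 0 < κ ∧ κ * (1 + 8 * L) ≤ 1 / 2 ∧ 8 * κ * p < c := by
    refine ⟨min (1 / (2 * (1 + 8 * L))) (c / (16 * p)), by positivity, ?_, ?_⟩
    · calc _ ≤ 1 / (2 * (1 + 8 * L)) * (1 + 8 * L) := by gcongr; exact min_le_left _ _
        _ = 1 / 2 := by field_simp
    · calc _ ≤ 8 * (c / (16 * p)) * p := by gcongr; exact min_le_right _ _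
        _ = c / 2 := by field_simp; norm_num
        _ < c := by linarith
  have hκ8 : 8 * κ < 1 / 2 := by nlinarith
  have hbern : 1 - c < (1 - 8 * κ) ^ p := by
    have := one_add_mul_le_pow (by linarith : (-2 : ℝ) ≤ -(8 * κ)) p
    rw [← sub_eq_add_neg] at this
    linarith
  refine ⟨max 1 (8 ^ p * (C₀ * (κ⁻¹) ^ p)), le_max_left _ _, ?_⟩
  intro A hA g hg u hu hupos huΓ hu1 x hx hx0 hx2
  have hdc := continuous_dep hK hg
  have H := hharn A hA u _ hu fun y hy => (hupos y hy).le
  set ub : Spc m → ℝ := fun x => if 0 < dep g x then u x else 0 with hub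
  have hubpos : ∀ y : Spc m, 0 < dep g y → ub y = u y := fun y hy => if_pos hy
  set F : Set (Spc m) := {x | ‖xprime x‖ ≤ 7 / 8 ∧ 0 ≤ dep g x ∧ dep g x ≤ 1 / 2} with hF
  set ψ : Spc m → ℝ := fun x => (7 / 8 - ‖xprime x‖) ^ p * ub x with hψ
  have hψc : ContinuousOn ψ F := by
    refine ContinuousOn.mul ?_ ?_
    · exact ((continuous_const.sub continuous_xprime.norm).pow p).continuousOn
    · refine (huΓ.continuousOn_extend hK hg hu.continuousOn).mono fun y hy => ?_
      exact ⟨by linarith [hy.1], by linarith [hy.2.2]⟩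
  have hxF : x ∈ F := ⟨by linarith, hx0.le, hx2⟩
  obtain ⟨x₀, hx₀F, hmax⟩ := (isCompact_closed_cylinder hK hg (7 / 8) (1 / 2)).exists_isMaxOn
    ⟨x, hxF⟩ hψc
  have hmax : ∀ y ∈ F, ψ y ≤ ψ x₀ := hmax
  have hCyl : ∀ y : Spc m, ‖xprime y‖ < 1 → 0 < dep g y → dep g y ≤ 1 / 2 → y ∈ CylE g 1 :=
    fun y h1 h2 h3 => (mem_CylE_iff g 1 y).mpr ⟨h1, h2, by linarith⟩
  have hux := hupos x (hCyl x (by linarith) hx0 hx2)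
  have hψx : 0 < ψ x := by
    simp only [hψ]; rw [hubpos x hx0]
    have : 0 < 7 / 8 - ‖xprime x‖ := by linarith
    positivity
  have hψ0 : 0 < ψ x₀ := hψx.trans_le (hmax x hxF)
  obtain ⟨hx₀1, hx₀2, hx₀3⟩ := hx₀F
  have hd0 : 0 < dep g x₀ := by
    rcases hx₀2.eq_or_lt with h | h
    · simp [hψ, hub, ← h] at hψ0
    · exact h
  set τ : ℝ := 7 / 8 - ‖xprime x₀‖ with hτ
  have hτ0 : 0 < τ := by
    rcases (by linarith : 0 ≤ τ).eq_or_lt with h | h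
    · simp [hψ, ← hτ, ← h, hp0] at hψ0
    · exact h
  have hu₀ := hupos x₀ (hCyl x₀ (by linarith) hd0 hx₀3)
  have hψx₀ : ψ x₀ = τ ^ p * u x₀ := by simp only [hψ]; rw [hubpos x₀ hd0]
  have key : ψ x₀ ≤ C₀ * (κ⁻¹) ^ p := by
    by_cases hcase : κ * τ ≤ dep g x₀
    · have h1 := hpow g hg u H hu1 x₀ hx₀1 hd0 hx₀3
      have h2 : ((dep g x₀)⁻¹) ^ p ≤ ((κ * τ)⁻¹) ^ p := by gcongr
      calc ψ x₀ = τ ^ p * u x₀ := hψx₀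
        _ ≤ τ ^ p * (C₀ * ((κ * τ)⁻¹) ^ p) := by gcongr; exact h1.trans (by gcongr)
        _ = C₀ * (κ⁻¹) ^ p := by rw [mul_inv, mul_pow, inv_pow τ]; field_simp
    · exfalso
      have hcase : dep g x₀ < κ * τ := not_le.mp hcase
      set d := dep g x₀ with hd
      have hτ1 : τ ≤ 7 / 8 := by linarith [norm_nonneg (xprime x₀)]
      have hball : ∀ y ∈ ball x₀ (8 * d), (1 - 8 * κ) * τ ≤ 7 / 8 - ‖xprime y‖ ∧
          dep g y ≤ 1 / 2 := by
        intro y hy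
        have hy : dist y x₀ < 8 * d := hy
        have h1 := (abs_le.mp (abs_dep_sub_le hK hg y x₀)).2
        have h2 := norm_xprime_sub_le y x₀
        have h3 := norm_sub_norm_le (xprime y) (xprime x₀)
        have h4 : (1 + K) * dist y x₀ ≤ (1 + K) * (8 * d) := by gcongr
        refine ⟨by linarith, ?_⟩
        have h5 : dep g y ≤ (1 + 8 * L) * d := by rw [hL]; linarith
        have h6 : (1 + 8 * L) * d ≤ (1 + 8 * L) * (κ * τ) := by gcongr
        nlinarith
      have hτκ : 0 < (1 - 8 * κ) * τ := by nlinarith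
      have hbCyl : ∀ y ∈ ball x₀ (8 * d), 0 < dep g y → y ∈ CylE g 1 := fun y hy hy0 =>
        hCyl y (by linarith [(hball y hy).1]) hy0 (hball y hy).2
      set M : ℝ := u x₀ / (1 - 8 * κ) ^ p with hM
      have hq0 : 0 < (1 - 8 * κ) ^ p := by
        have : 0 < 1 - 8 * κ := by linarith
        positivity
      have huM : ∀ y ∈ ball x₀ (8 * d), 0 < dep g y → u y ≤ M := by
        intro y hy hy0
        obtain ⟨h1, h2⟩ := hball y hy
        have h3 := hmax y ⟨by linarith, hy0.le, h2⟩
        rw [hψx₀] at h3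
        simp only [hψ] at h3
        rw [hubpos y hy0] at h3
        have hy1 := hupos y (hbCyl y hy hy0)
        have h4 : ((1 - 8 * κ) * τ) ^ p * u y ≤ τ ^ p * u x₀ := by
          refine le_trans ?_ h3; gcongr
        rw [hM, le_div_iff₀ hq0]
        rw [mul_pow] at h4
        have hτp : 0 < τ ^ p := by positivity
        refine le_of_mul_le_mul_left ?_ hτp
        linarith
      have h := hdecay A hA g hg (fun y => (-1) * u y + 0) x₀ d M hd0 (by positivity) hd0 le_rfl
        ((hu.affine (-1) 0).mono fun y hy => hbCyl y hy.2 hy.1)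
        (fun y hy hy0 => by have := huM y hy hy0; linarith)
        (fun z hz hz0 ε hε => by
          have h1 : ‖xprime z‖ < 1 := by linarith [(hball z hz).1]
          have h2 := (huΓ.tendsto_above hK hg hz0 h1).eventually (gt_mem_nhds hε)
          filter_upwards [h2] with y hy
          linarith)
      have h1 : u x₀ ≤ (1 - c) * M := by linarith
      rw [hM, mul_div_assoc', le_div_iff₀ hq0] at h1
      nlinarith
  have h8 : (1 / 8 : ℝ) ^ p * u x ≤ ψ x := by
    simp only [hψ]; rw [hubpos x hx0]
    gcongr; linarith
  have h9 := (h8.trans (hmax x hxF)).trans key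
  refine le_trans ?_ (le_max_right _ _)
  calc u x = 8 ^ p * ((1 / 8 : ℝ) ^ p * u x) := by
        rw [← mul_assoc, ← mul_pow]; norm_num
    _ ≤ _ := by gcongr

/-- On the cylinder of size `r` over `p`, `w ≥ -b`, and `w ≥ M b` at heights at least `δ r`. -/
def LowerBd (g : Spc' m → ℝ) (w : Spc m → ℝ) (p : Spc' m) (δ M r b : ℝ) : Prop :=
  (∀ x : Spc m, ‖xprime x - p‖ < r → 0 < dep g x → dep g x < r → -b ≤ w x) ∧
  (∀ x : Spc m, ‖xprime x - p‖ < r → δ * r ≤ dep g x → dep g x < r → M * b ≤ w x)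

/-- One upward Harnack chain inside the cylinder of size `r` over `p`, from heights at least
`δ r / 2` to heights at least `δ r`. -/
lemma exists_upward_chain (m : ℕ) {lam Lam K : ℝ} (hlam : 0 < lam) (hLam : lam ≤ Lam)
    (hK : 0 < K) :
    ∃ c₀ : ℝ, 0 < c₀ ∧ c₀ ≤ 1 ∧
      ∀ A : Spc m → Matrix (Fin (m + 1)) (Fin (m + 1)) ℝ, IsElliptic lam Lam A →
      ∀ g : Spc' m → ℝ, (∀ x' y', |g x' - g y'| ≤ K * ‖x' - y'‖) →
      ∀ (w : Spc m → ℝ) (p : Spc' m) (δ M r b : ℝ), 0 < δ → δ ≤ 1 / 2 → 0 < r →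
        SolvesE A w {x | ‖xprime x - p‖ < r ∧ 0 < dep g x ∧ dep g x < r} →
        LowerBd g w p δ M r b →
        ∀ x : Spc m, ‖xprime x - p‖ < r / 2 → δ * (r / 2) ≤ dep g x → dep g x < δ * r →
          c₀ * (M * b + b) ≤ w x + b := by
  obtain ⟨C, hC, hharn⟩ := exists_harnackOn m hlam hLam
  set L : ℝ := 1 + K with hL
  have hL1 : 1 < L := by linarith
  obtain ⟨N, hN⟩ := exists_nat_gt (8 * L)
  have hN0 : N ≠ 0 := by
    rintro rfl
    rw [Nat.cast_zero] at hN
    linarith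
  have hCN : 1 ≤ C ^ N := one_le_pow₀ hC
  refine ⟨(C ^ N)⁻¹, by positivity, inv_le_one_of_one_le₀ hCN, ?_⟩
  intro A hA g hg w p δ M r b hδ hδ2 hr hw hP x hx hx1 hx2
  set Ω : Set (Spc m) := {x | ‖xprime x - p‖ < r ∧ 0 < dep g x ∧ dep g x < r} with hΩ
  have hδr : 0 < δ * r := by positivity
  have hδr2 : δ * r ≤ r / 2 := by nlinarith
  have H := hharn A hA (fun y => 1 * w y + b) Ω (hw.affine 1 b)
    (fun y hy => by have := hP.1 y hy.1 hy.2.1 hy.2.2; linarith)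
  set ρ : ℝ := δ * r / (8 * L) with hρ
  have hρ0 : 0 < ρ := by positivity
  have hρL : L * ρ = δ * r / 8 := by rw [hρ]; field_simp
  have hρ1 : ρ ≤ δ * r / 8 := by nlinarith
  set γ : ℝ → Spc m := fun t => graphPt g (xprime x) (dep g x + t * (δ * r / 2)) with hγ
  have hγ0 : γ 0 = x := by simp [hγ, graphPt_self]
  have hlip : ∀ s ∈ Icc (0 : ℝ) 1, ∀ t ∈ Icc (0 : ℝ) 1, dist (γ s) (γ t) ≤ δ * r / 2 * |s - t| := by
    intro s _ t _
    simp only [hγ]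
    rw [dist_graphPt_vert, show dep g x + s * (δ * r / 2) - (dep g x + t * (δ * r / 2)) =
      δ * r / 2 * (s - t) by ring, abs_mul, abs_of_pos (by positivity)]
  have hball : ∀ t ∈ Icc (0 : ℝ) 1, closedBall (γ t) (3 * ρ) ⊆ Ω := by
    rintro t ⟨ht0, ht1⟩ y hy
    have hy : dist y (γ t) ≤ 3 * ρ := hy
    have h1 := abs_le.mp (abs_dep_sub_le hK hg y (γ t))
    have h2 := norm_xprime_sub_le y (γ t)
    have h3 : (1 + K) * dist y (γ t) ≤ (1 + K) * (3 * ρ) := by gcongr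
    have h4 : (1 + K) * (3 * ρ) = 3 * (δ * r / 8) := by rw [← hρL, hL]; ring
    have hd : dep g (γ t) = dep g x + t * (δ * r / 2) := dep_graphPt _ _ _
    have hp : xprime (γ t) = xprime x := xprime_graphPt _ _ _
    rw [hp] at h2
    have h5 := norm_sub_le_norm_sub_add_norm_sub (xprime y) (xprime x) p
    have h6 : t * (δ * r / 2) ≤ δ * r / 2 := by nlinarith
    have h7 : 0 ≤ t * (δ * r / 2) := by positivity
    exact ⟨by linarith, by linarith, by linarith⟩
  have h := harnack_chain hC H hρ0 hlip hball (N := N) (by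
    have : 8 * L * (ρ / 2) ≤ N * (ρ / 2) := by gcongr
    linarith) hN0
  rw [hγ0] at h
  have h1 : M * b ≤ w (γ 1) := by
    have hd : dep g (γ 1) = dep g x + 1 * (δ * r / 2) := dep_graphPt _ _ _
    have hp : xprime (γ 1) = xprime x := xprime_graphPt _ _ _
    exact hP.2 _ (by rw [hp]; linarith) (by rw [hd]; linarith) (by rw [hd]; linarith)
  rw [inv_mul_le_iff₀ (by positivity)]
  linarith

/-- Improvement of lower bounds when passing to a cylinder of half the size. -/
lemma exists_lower_step (m : ℕ) {lam Lam K : ℝ} (hlam : 0 < lam) (hLam : lam ≤ Lam)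
    (hK : 0 < K) :
    ∃ a δ M : ℝ, 0 < a ∧ 0 < δ ∧ δ ≤ 1 / 2 ∧ 0 < M ∧
      ∀ A : Spc m → Matrix (Fin (m + 1)) (Fin (m + 1)) ℝ, IsElliptic lam Lam A →
      ∀ g : Spc' m → ℝ, (∀ x' y', |g x' - g y'| ≤ K * ‖x' - y'‖) →
      ∀ w : Spc m → ℝ, SolvesE A w (CylE g 1) → VanishesOnE w (CylE g 1) (graphSetE g) →
      ∀ (p : Spc' m) (r b : ℝ), ‖p‖ < 1 / 2 → 0 < r → r ≤ 1 / 4 → 0 < b →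
        LowerBd g w p δ M r b → LowerBd g w p δ M (r / 2) (a * b) := by
  obtain ⟨c₀, hc₀, hc₀1, hchain⟩ := exists_upward_chain m hlam hLam hK
  obtain ⟨c, hc0, hc1, hdecay⟩ := exists_boundary_decay m (Lam := Lam) hlam hK
  set L : ℝ := 1 + K with hL
  have hL1 : 1 < L := by linarith
  obtain ⟨k, hk⟩ := exists_pow_lt_of_lt_one (by positivity : 0 < c₀ / 2) (by linarith : 1 - c < 1)
  obtain ⟨δ, hδ0, hδL, hδk⟩ : ∃ δ : ℝ, 0 < δ ∧ δ * (2 + 8 * L) ≤ 1 ∧ 8 * k * δ ≤ 1 / 2 := by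
    refine ⟨min (1 / (2 + 8 * L)) (1 / (16 * (k + 1))), by positivity, ?_, ?_⟩
    · calc _ ≤ 1 / (2 + 8 * L) * (2 + 8 * L) := by gcongr; exact min_le_left _ _
        _ = 1 := by field_simp
    · calc _ ≤ 8 * (k : ℝ) * (1 / (16 * (k + 1))) := by gcongr; exact min_le_right _ _
        _ ≤ 1 / 2 := by
          rw [mul_one_div, div_le_div_iff₀ (by positivity) (by norm_num)]; nlinarith
  have hδ2 : δ ≤ 1 / 2 := by nlinarith
  refine ⟨c₀ / 2, δ, 2 / c₀, by positivity, hδ0, hδ2, by positivity, ?_⟩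
  intro A hA g hg w hw hwΓ p r b hp hr hr4 hb hP
  have hcyl : ∀ x : Spc m, ‖xprime x - p‖ < r → 0 < dep g x → dep g x < r → x ∈ CylE g 1 := by
    intro x h1 h2 h3
    have := norm_sub_norm_le (xprime x) p
    exact (mem_CylE_iff g 1 x).mpr ⟨by linarith, h2, by linarith⟩
  have hδr : 0 < δ * r := by positivity
  have hδr2 : δ * r ≤ r / 2 := by nlinarith
  have hMb : 2 / c₀ * (c₀ / 2 * b) = b := by field_simp
  have hM2 : 2 ≤ 2 / c₀ := by rw [le_div_iff₀ hc₀]; linarith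
  have hupper : ∀ x : Spc m, ‖xprime x - p‖ < r / 2 → δ * (r / 2) ≤ dep g x → dep g x < r / 2 →
      b ≤ w x := by
    intro x h1 h2 h3
    by_cases h4 : δ * r ≤ dep g x
    · have := hP.2 x (by linarith) h4 (by linarith)
      nlinarith
    · have h5 := hchain A hA g hg w p δ (2 / c₀) r b hδ0 hδ2 hr
        (hw.mono fun y hy => hcyl y hy.1 hy.2.1 hy.2.2) hP x h1 h2 (not_le.mp h4)
      have e : c₀ * (2 / c₀ * b + b) = 2 * b + c₀ * b := by field_simp
      rw [e] at h5
      nlinarith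
  have hdec : ∀ j : ℕ, ∀ x : Spc m, ‖xprime x - p‖ < r - 8 * j * (δ * r) → 0 < dep g x →
      dep g x < δ * r → -((1 - c) ^ j * b) ≤ w x := by
    intro j
    induction j with
    | zero =>
      intro x h1 h2 h3
      have := hP.1 x (by simpa using h1) h2 (by linarith)
      simpa using this
    | succ j ih =>
      intro x h1 h2 h3
      push_cast at h1
      have hcpos : 0 < (1 - c) ^ j := by
        have : 0 < 1 - c := by linarith
        positivity
      have hjpos : 0 ≤ 8 * (j : ℝ) * (δ * r) := by positivity
      have hball : ∀ y ∈ ball x (8 * (δ * r)), ‖xprime y - p‖ < r - 8 * j * (δ * r) ∧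
          dep g y < r := by
        intro y hy
        have hy : dist y x < 8 * (δ * r) := hy
        have h4 := (abs_le.mp (abs_dep_sub_le hK hg y x)).2
        have h5 := norm_xprime_sub_le y x
        have h6 := norm_sub_le_norm_sub_add_norm_sub (xprime y) (xprime x) p
        have h7 : (1 + K) * dist y x ≤ (1 + K) * (8 * (δ * r)) := by gcongr
        refine ⟨by linarith, ?_⟩
        have h8 : δ * (2 + 8 * L) * r ≤ 1 * r := by gcongr
        have h9 : dep g y < (1 + 8 * L) * (δ * r) := by rw [hL]; linarith
        linarith
      have h := hdecay A hA g hg w x (δ * r) ((1 - c) ^ j * b) hδr (by positivity) h2 h3.le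
        (hw.mono fun y hy => by
          obtain ⟨h4, h5⟩ := hball y hy.2
          exact hcyl y (by linarith) hy.1 h5)
        (fun y hy hy0 => by
          obtain ⟨h4, h5⟩ := hball y hy
          by_cases h6 : dep g y < δ * r
          · exact ih y h4 hy0 h6
          · have h7 := hP.2 y (by linarith) (not_lt.mp h6) h5
            have h8 : 0 < (1 - c) ^ j * b := by positivity
            have h9 : 0 < 2 / c₀ * b := by positivity
            linarith)
        (fun z hz hz0 ε hε => by
          obtain ⟨h4, h5⟩ := hball z hz
          have h6 := norm_sub_norm_le (xprime z) p
          exact (hwΓ.tendsto_above hK hg hz0 (by linarith)).eventually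
            (lt_mem_nhds (by linarith)))
      rw [pow_succ']
      linarith
  constructor
  · intro x h1 h2 h3
    have hab : 0 < c₀ / 2 * b := by positivity
    by_cases h4 : δ * (r / 2) ≤ dep g x
    · have := hupper x h1 h4 h3
      linarith
    · have h5 : 8 * k * δ * r ≤ 1 / 2 * r := by gcongr
      have h6 := hdec k x (by linarith) h2 (by linarith)
      have h7 : (1 - c) ^ k * b ≤ c₀ / 2 * b := by gcongr
      linarith
  · intro x h1 h2 h3
    rw [hMb]
    exact hupper x h1 h2 h3

/-- One-sided comparison of two normalized positive solutions vanishing on the graph. -/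
lemma exists_boundary_comparison (m : ℕ) {lam Lam K : ℝ} (hlam : 0 < lam) (hLam : lam ≤ Lam)
    (hK : 0 < K) :
    ∃ C : ℝ, 0 < C ∧
      ∀ A : Spc m → Matrix (Fin (m + 1)) (Fin (m + 1)) ℝ, IsElliptic lam Lam A →
      ∀ g : Spc' m → ℝ, (∀ x' y', |g x' - g y'| ≤ K * ‖x' - y'‖) →
      ∀ u v : Spc m → ℝ, SolvesE A u (CylE g 1) → SolvesE A v (CylE g 1) →
        (∀ x ∈ CylE g 1, 0 < u x) → (∀ x ∈ CylE g 1, 0 < v x) →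
        VanishesOnE u (CylE g 1) (graphSetE g) → VanishesOnE v (CylE g 1) (graphSetE g) →
        u (graphPt g 0 (1 / 2)) = 1 → v (graphPt g 0 (1 / 2)) = 1 →
        ∀ x ∈ CylE g (1 / 2), v x ≤ C * u x := by
  obtain ⟨C, hC, hharn⟩ := exists_harnackOn m hlam hLam
  obtain ⟨C₁, hC₁, hcarl⟩ := exists_carleson m hlam hLam hK
  obtain ⟨a, δ, M, ha, hδ, hδ2, hM, hstep⟩ := exists_lower_step m hlam hLam hK
  obtain ⟨C₂, hC₂, hI⟩ := exists_interior_bound m hK hC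
    (by positivity : 0 < δ * (1 / 4)) (by linarith)
  refine ⟨(M + 1) * C₁ * C₂, by positivity, ?_⟩
  intro A hA g hg u v hu hv hu0 hv0 huΓ hvΓ hu1 hv1 x hx
  obtain ⟨hx1, hx2, hx3⟩ := (mem_CylE_iff g _ x).mp hx
  have Hu := hharn A hA u _ hu fun y hy => (hu0 y hy).le
  have hulow : ∀ y : Spc m, ‖xprime y‖ ≤ 7 / 8 → δ * (1 / 4) ≤ dep g y → dep g y ≤ 1 / 2 →
      1 ≤ C₂ * u y := by
    intro y h1 h2 h3
    have := (hI g hg u Hu y h1 h2 h3).2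
    rwa [hu1] at this
  have hvup := hcarl A hA g hg v hv hv0 hvΓ hv1
  by_cases hx4 : 1 / 4 ≤ dep g x
  · have h1 := hulow x (by linarith) (by linarith) hx3.le
    have h2 := hvup x (by linarith) hx2 hx3.le
    nlinarith [mul_pos hM (by linarith : 0 < C₁)]
  have hx4 : dep g x < 1 / 4 := not_le.mp hx4
  set w : Spc m → ℝ := fun y => (M + 1) * C₁ * C₂ * u y + (-1) * v y + 0 with hw
  set p := xprime x with hp
  have hstart : LowerBd g w p δ M (1 / 4) C₁ := by
    constructor
    · intro y h1 h2 h3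
      have h4 := norm_sub_norm_le (xprime y) p
      have h5 := hvup y (by linarith) h2 (by linarith)
      have h6 := hu0 y ((mem_CylE_iff g 1 y).mpr ⟨by linarith, h2, by linarith⟩)
      have h7 : 0 < (M + 1) * C₁ * C₂ * u y := by positivity
      simp only [hw]
      linarith
    · intro y h1 h2 h3
      have h4 := norm_sub_norm_le (xprime y) p
      have h0 : 0 < δ * (1 / 4) := by positivity
      have h5 := hvup y (by linarith) (by linarith) (by linarith)
      have h6 := hulow y (by linarith) h2 (by linarith)
      have h7 : (M + 1) * C₁ * 1 ≤ (M + 1) * C₁ * (C₂ * u y) := by gcongr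
      simp only [hw]
      linarith
  have hiter : ∀ j : ℕ, LowerBd g w p δ M (1 / 4 * (1 / 2) ^ j) (a ^ j * C₁) := by
    intro j
    induction j with
    | zero => simpa using hstart
    | succ j ih =>
      have h1 : (1 / 2 : ℝ) ^ j ≤ 1 := pow_le_one₀ (by norm_num) (by norm_num)
      have := hstep A hA g hg w (hu.comb hv _ (-1) 0) (huΓ.comb hvΓ _ (-1)) p _ _ hx1
        (by positivity : (0 : ℝ) < 1 / 4 * (1 / 2) ^ j) (by linarith)
        (by positivity : 0 < a ^ j * C₁) ih
      convert this using 1 <;> ring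
  have hex : ∃ n : ℕ, (1 / 2 : ℝ) ^ n ≤ 4 * dep g x :=
    (exists_pow_lt_of_lt_one (by linarith) (by norm_num)).imp fun _ => le_of_lt
  obtain ⟨j, hj⟩ : ∃ j, Nat.find hex = j + 1 := Nat.exists_eq_succ_of_ne_zero fun h => by
    have := Nat.find_spec hex
    rw [h, pow_zero] at this
    linarith
  have hj1 := Nat.find_spec hex
  have hj2 := not_le.mp (Nat.find_min hex (by omega : j < Nat.find hex))
  rw [hj, pow_succ] at hj1
  have hjpos : (0 : ℝ) < (1 / 2) ^ j := by positivity
  have h1 : δ * (1 / 4 * (1 / 2) ^ j) ≤ 1 / 2 * (1 / 4 * (1 / 2) ^ j) := by gcongr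
  have h2 := (hiter j).2 x (by rw [sub_self, norm_zero]; positivity) (by linarith) (by linarith)
  have h3 : 0 < M * (a ^ j * C₁) := by positivity
  simp only [hw] at h2
  linarith

/-- The reference point `eₙ / 2` is the point at height `1/2` over the origin. -/
lemma graphPt_zero_half {g : Spc' m → ℝ} (h0 : g 0 = 0) :
    graphPt g 0 (1 / 2) = EuclideanSpace.single (Fin.last m) ((1 : ℝ) / 2) := by
  refine eq_of_xprime_xlast ?_ ?_
  · rw [xprime_graphPt]
    ext i
    simp [xprime_apply, (Fin.castSucc_lt_last i).ne]
  · rw [xlast_graphPt, h0]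
    simp [xlast]

end

/-- **Elliptic boundary Harnack principle in Lipschitz domains** (Theorem 1.5). -/
theorem elliptic_boundary_harnack (m : ℕ) (hm : 1 ≤ m) (lam Lam K : ℝ)
    (hlam : 0 < lam) (hlamLam : lam ≤ Lam) (hK : 0 < K) :
    ∃ C : ℝ, 0 < C ∧
      ∀ (A : Spc m → Matrix (Fin (m + 1)) (Fin (m + 1)) ℝ), IsElliptic lam Lam A →
      ∀ g : Spc' m → ℝ,
        (∀ x' y', |g x' - g y'| ≤ K * ‖x' - y'‖) → g 0 = 0 →
      ∀ u v : Spc m → ℝ,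
        SolvesE A u (CylE g 1) → SolvesE A v (CylE g 1) →
        (∀ x ∈ CylE g 1, 0 < u x) → (∀ x ∈ CylE g 1, 0 < v x) →
        VanishesOnE u (CylE g 1) (graphSetE g) →
        VanishesOnE v (CylE g 1) (graphSetE g) →
        u (EuclideanSpace.single (Fin.last m) ((1 : ℝ) / 2)) = 1 →
        v (EuclideanSpace.single (Fin.last m) ((1 : ℝ) / 2)) = 1 →
        ∀ x ∈ CylE g (1 / 2), C⁻¹ ≤ u x / v x ∧ u x / v x ≤ C := by
  obtain ⟨C, hC, H⟩ := exists_boundary_comparison m hlam hlamLam hK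
  refine ⟨C, hC, ?_⟩
  intro A hA g hg hg0 u v hu hv hu0 hv0 huΓ hvΓ hu1 hv1 x hx
  rw [← graphPt_zero_half hg0] at hu1 hv1
  obtain ⟨hx1, hx2, hx3⟩ := (mem_CylE_iff g _ x).mp hx
  have hvx := hv0 x ((mem_CylE_iff g 1 x).mpr ⟨by linarith, hx2, by linarith⟩)
  constructor
  · rw [le_div_iff₀ hvx, inv_mul_le_iff₀ hC]
    exact H A hA g hg u v hu hv hu0 hv0 huΓ hvΓ hu1 hv1 x hx
  · rw [div_le_iff₀ hvx]
    exact H A hA g hg v u hv hu hv0 hu0 hvΓ huΓ hv1 hu1 x hx
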